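/- arXiv:2005.11559 — 2 statements merged into one kernel-verified Lean document; each statement's English description precedes it below -/
import Mathlib

section
/- Assume Hypothesis (U-cube). Then for every real α with 0 < α < 1/11 there exist constants c > 0 and C₀ ≥ 1 (depending only on α and on the constant in (U-cube)) such that every set of cubes A with |A| ≥ 2 satisfies E(A) ≤ C₀·|A|^{5/2}·exp(−c·(log |A|)^α), where E(A) = Σ_x r_{A−A}(x)² is the additive energy of A. -/
open Finset Pointwise

/-- Hypothesis (U-cube): an instance of the Uniformity Conjecture for the genus-4 curves
`y³ = (x³ + a)(x³ + b)` with distinct nonzero `a, b`. -/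
def UCube (C : ℕ) : Prop :=
  ∀ a b : ℤ, a ≠ 0 → b ≠ 0 → a ≠ b →
    {p : ℚ × ℚ | p.2 ^ 3 = (p.1 ^ 3 + (a : ℚ)) * (p.1 ^ 3 + (b : ℚ))}.Finite ∧
    {p : ℚ × ℚ | p.2 ^ 3 = (p.1 ^ 3 + (a : ℚ)) * (p.1 ^ 3 + (b : ℚ))}.ncard ≤ C

/-- The additive energy `E(A) = Σ_x r_{A−A}(x)²`. -/
def addEnergy (A : Finset ℤ) : ℕ :=
  ∑ x ∈ A - A, ((A ×ˢ A).filter (fun p => p.1 - p.2 = x)).card ^ 2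

/-- `x ↦ (x, uv)` embeds the simultaneous solutions of `x³ + a = u³`, `x³ + b = v³` into the
curve of Hypothesis (U-cube). -/
lemma UCube.card_le {C : ℕ} (hU : UCube C) {a b : ℤ} (ha : a ≠ 0) (hb : b ≠ 0) (hab : a ≠ b)
    (S : Finset ℚ) (hS : ∀ x ∈ S, ∃ u v : ℚ, x ^ 3 + a = u ^ 3 ∧ x ^ 3 + b = v ^ 3) :
    #S ≤ C := by
  obtain ⟨hfin, hcard⟩ := hU a b ha hb hab
  choose! u v hu hv using hS
  refine le_trans ?_ hcard
  rw [← Set.ncard_coe_finset]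
  refine Set.ncard_le_ncard_of_injOn (fun x => (x, u x * v x)) ?_ ?_ hfin
  · intro x hx
    simp only [Set.mem_ofPred_eq]
    rw [hu x hx, hv x hx]; ring
  · intro x _ y _ h
    exact (Prod.ext_iff.1 h).1

/-- The representation function `r_{A-A}(x)`, counted by the first summand. -/
def diffRep (A : Finset ℤ) (x : ℤ) : ℕ := #{a ∈ A | a + x ∈ A}

lemma UCube.card_triple_le {C : ℕ} (hU : UCube C) {A : Finset ℤ}
    (hA : ∀ a ∈ A, ∃ m : ℤ, a = m ^ 3) {x y : ℤ} (hx : x ≠ 0) (hy : y ≠ 0) (hxy : x ≠ y) :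
    #{a ∈ A | a + x ∈ A ∧ a + y ∈ A} ≤ C := by
  choose! m hm using hA
  have hinj : Set.InjOn (fun a => (m a : ℚ)) ({a ∈ A | a + x ∈ A ∧ a + y ∈ A} : Finset ℤ) := by
    intro a ha b hb h
    simp only [coe_filter, Set.mem_ofPred_eq] at ha hb
    have h' : m a = m b := Int.cast_injective (α := ℚ) h
    rw [hm a ha.1, hm b hb.1, h']
  rw [← card_image_of_injOn hinj]
  refine hU.card_le hx hy hxy _ ?_
  intro z hz
  obtain ⟨a, ha, rfl⟩ := mem_image.1 hz
  simp only [mem_filter] at ha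
  refine ⟨m (a + x), m (a + y), ?_, ?_⟩
  · have h1 := hm a ha.1
    have h2 := hm _ ha.2.1
    have : (m a) ^ 3 + x = m (a + x) ^ 3 := by rw [← h1, ← h2]
    exact_mod_cast this
  · have h1 := hm a ha.1
    have h2 := hm _ ha.2.2
    have : (m a) ^ 3 + y = m (a + y) ^ 3 := by rw [← h1, ← h2]
    exact_mod_cast this

lemma card_filter_sub_eq (A : Finset ℤ) (x : ℤ) :
    #{p ∈ A ×ˢ A | p.1 - p.2 = x} = diffRep A x := by
  refine card_nbij' (fun p => p.2) (fun a => (a + x, a)) ?_ ?_ ?_ ?_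
  · rintro ⟨p, q⟩ h
    simp only [coe_filter, mem_product, Set.mem_ofPred_eq] at h ⊢
    obtain ⟨⟨h1, h2⟩, rfl⟩ := h
    exact ⟨h2, by simpa using h1⟩
  · intro a h
    simp only [coe_filter, mem_product, Set.mem_ofPred_eq] at h ⊢
    exact ⟨⟨h.2, h.1⟩, by ring⟩
  · rintro ⟨p, q⟩ h
    simp only [coe_filter, mem_product, Set.mem_ofPred_eq] at h ⊢
    ext <;> simp; linarith [h.2]
  · intro a _; rfl

lemma addEnergy_eq (A : Finset ℤ) : _root_.addEnergy A = ∑ x ∈ A - A, diffRep A x ^ 2 :=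
  sum_congr rfl fun x _ => by rw [card_filter_sub_eq]

lemma diffRep_neg (A : Finset ℤ) (x : ℤ) : diffRep A (-x) = diffRep A x := by
  refine card_nbij' (fun a => a - x) (fun a => a + x) ?_ ?_ ?_ ?_
  · intro a h
    simp only [coe_filter, Set.mem_ofPred_eq] at h ⊢
    exact ⟨by simpa [sub_eq_add_neg] using h.2, by simpa using h.1⟩
  · intro a h
    simp only [coe_filter, Set.mem_ofPred_eq] at h ⊢
    exact ⟨h.2, by simpa using h.1⟩
  · intro a _; simp
  · intro a _; simp

lemma diffRep_le_card (A : Finset ℤ) (x : ℤ) : diffRep A x ≤ #A := card_filter_le _ _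

/-- Sums over pairs of elements of `A` are sums over differences weighted by `r_{A-A}`. -/
lemma sum_pairs_eq (A : Finset ℤ) (g : ℤ → ℝ) :
    ∑ a ∈ A, ∑ b ∈ A, g (a - b) = ∑ x ∈ A - A, diffRep A x * g x := by
  rw [← sum_product', ← sum_fiberwise_of_maps_to (s := A ×ˢ A) (t := A - A)
    (g := fun p : ℤ × ℤ => p.1 - p.2)
    (fun p hp => sub_mem_sub (mem_product.1 hp).1 (mem_product.1 hp).2)]
  refine sum_congr rfl fun x _ => ?_
  rw [← card_filter_sub_eq, ← nsmul_eq_mul, ← sum_const]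
  exact sum_congr rfl fun p hp => by rw [(mem_filter.1 hp).2]

/-- For a Gram matrix `M = χχᵀ`, the number of weighted triangles is at least what the sum of the
entries of `M` predicts. -/
lemma sum_gram_pow_three_le {ι κ : Type*} (s : Finset ι) (U : Finset κ) (χ : ι → κ → ℝ)
    (M : ι → ι → ℝ) (hM : ∀ a b, M a b = ∑ u ∈ U, χ a u * χ b u) :
    (∑ a ∈ s, ∑ b ∈ s, M a b) ^ 3 ≤
      (#s : ℝ) ^ 3 * ∑ a ∈ s, ∑ b ∈ s, ∑ c ∈ s, M a b * M a c * M b c := by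
  set E := ∑ a ∈ s, ∑ b ∈ s, M a b with hE
  set T := ∑ a ∈ s, ∑ b ∈ s, ∑ c ∈ s, M a b * M a c * M b c with hT
  set R : ι → ℝ := fun b => ∑ a ∈ s, M a b with hR
  set n : ℝ := (#s : ℝ)
  have hn : 0 ≤ n := Nat.cast_nonneg _
  have hER : E = ∑ b ∈ s, R b := by rw [hE, sum_comm]
  have hEsq : E = ∑ u ∈ U, (∑ a ∈ s, χ a u) ^ 2 := by
    simp only [hE, hM, sq, sum_mul_sum]
    rw [sum_comm (s := U)]
    exact sum_congr rfl fun a _ => sum_comm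
  have hTsq : T = ∑ u ∈ U, ∑ a ∈ s, (∑ b ∈ s, M a b * χ b u) ^ 2 := by
    rw [hT, sum_comm (s := U)]
    refine sum_congr rfl fun a _ => ?_
    simp only [sq, sum_mul_sum]
    rw [sum_comm (s := U)]
    refine sum_congr rfl fun b _ => ?_
    rw [sum_comm (s := U)]
    refine sum_congr rfl fun c _ => ?_
    rw [hM b c, mul_sum]
    exact sum_congr rfl fun u _ => by ring
  have hE0 : 0 ≤ E := hEsq ▸ sum_nonneg fun _ _ => sq_nonneg _
  have hT0 : 0 ≤ T := hTsq ▸ sum_nonneg fun _ _ => sum_nonneg fun _ _ => sq_nonneg _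
  set P := ∑ b ∈ s, R b ^ 2 with hP
  have hP0 : 0 ≤ P := sum_nonneg fun _ _ => sq_nonneg _
  have h1 : E ^ 2 ≤ n * P := by rw [hER]; exact sq_sum_le_card_mul_sum_sq
  set Q := ∑ u ∈ U, (∑ b ∈ s, R b * χ b u) ^ 2 with hQ
  have hPu : P = ∑ u ∈ U, (∑ a ∈ s, χ a u) * (∑ b ∈ s, R b * χ b u) := by
    simp only [hP, sum_mul_sum]
    simp_rw [sum_comm (s := U)]
    rw [sum_comm (s := s) (t := s)]
    refine sum_congr rfl fun b _ => ?_
    rw [sq]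
    nth_rewrite 2 [hR]
    simp only [mul_sum, hM]
    refine sum_congr rfl fun a _ => ?_
    exact sum_congr rfl fun u _ => by ring
  have h2 : P ^ 2 ≤ E * Q := by
    rw [hPu, hEsq]; exact sum_mul_sq_le_sq_mul_sq _ _ _
  have h3 : Q ≤ n * T := by
    rw [hQ, hTsq, mul_sum]
    refine sum_le_sum fun u _ => ?_
    have : ∑ b ∈ s, R b * χ b u = ∑ a ∈ s, ∑ b ∈ s, M a b * χ b u := by
      simp only [hR, sum_mul]; exact sum_comm
    rw [this]
    exact sq_sum_le_card_mul_sum_sq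
  rcases hE0.eq_or_lt with h | h
  · rw [← h, zero_pow three_ne_zero]; positivity
  · have h4 : E ^ 4 ≤ n ^ 2 * P ^ 2 := by
      calc E ^ 4 = (E ^ 2) ^ 2 := by ring
        _ ≤ (n * P) ^ 2 := by gcongr
        _ = _ := by ring
    have h5 : E ^ 4 ≤ n ^ 2 * (E * (n * T)) := by
      refine h4.trans ?_
      gcongr
      exact h2.trans (by gcongr)
    have : E * E ^ 3 ≤ E * (n ^ 3 * T) := by nlinarith
    exact le_of_mul_le_mul_left this h

lemma diffRep_sub_eq_sum (A : Finset ℤ) {a b : ℤ} (ha : a ∈ A) :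
    (diffRep A (a - b) : ℝ) = ∑ u ∈ A - A,
      (if a + u ∈ A then (1 : ℝ) else 0) * (if b + u ∈ A then 1 else 0) := by
  simp only [← ite_and, mul_ite, mul_one, mul_zero]
  rw [← sum_filter, sum_const, nsmul_eq_mul, mul_one, Nat.cast_inj]
  refine card_nbij' (fun c => c - b) (fun u => b + u) ?_ ?_ ?_ ?_
  · intro c h
    simp only [coe_filter, Set.mem_ofPred_eq] at h ⊢
    have h1 : a + (c - b) ∈ A := by convert h.2 using 1; ring
    have h2 : b + (c - b) ∈ A := by simpa using h.1
    refine ⟨?_, h2, h1⟩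
    have := sub_mem_sub h1 ha
    simpa using this
  · intro u h
    simp only [coe_filter, Set.mem_ofPred_eq] at h ⊢
    refine ⟨h.2.1, ?_⟩
    convert h.2.2 using 1; ring
  · intro c _; simp
  · intro u _; simp

/-- The differences with more than `τ` representations have few representations in total when the
sets `A ∩ (A - x)` have small pairwise intersections. -/
lemma sum_diffRep_large_le {A : Finset ℤ} {C : ℕ}
    (hC : ∀ x y : ℤ, x ≠ 0 → y ≠ 0 → x ≠ y → #{a ∈ A | a + x ∈ A ∧ a + y ∈ A} ≤ C)
    {τ : ℝ} (hτ0 : 0 ≤ τ) (hτ : 4 * C * #A ≤ τ ^ 2) :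
    ∑ x ∈ (A - A).filter (fun x => τ < diffRep A x), (diffRep A x : ℝ) ≤ 3 * #A := by
  set X := (A - A).filter (fun x => x ≠ 0 ∧ τ < diffRep A x) with hX
  set χ : ℤ → ℤ → ℝ := fun a x => if a + x ∈ A then 1 else 0 with hχ
  set S := ∑ x ∈ X, (diffRep A x : ℝ) with hS
  have hr : ∀ x, (diffRep A x : ℝ) = ∑ a ∈ A, χ a x := by
    intro x; simp [diffRep, hχ]
  have hSg : S = ∑ a ∈ A, ∑ x ∈ X, χ a x := by
    simp only [hS, hr]; exact sum_comm
  have h1 : S ^ 2 ≤ #A * ∑ a ∈ A, (∑ x ∈ X, χ a x) ^ 2 := by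
    rw [hSg]; exact sq_sum_le_card_mul_sum_sq
  have h2 : ∑ a ∈ A, (∑ x ∈ X, χ a x) ^ 2 ≤ S + C * (#X : ℝ) ^ 2 := by
    have : ∑ a ∈ A, (∑ x ∈ X, χ a x) ^ 2 = ∑ x ∈ X, ∑ y ∈ X, ∑ a ∈ A, χ a x * χ a y := by
      simp only [sq, sum_mul_sum]
      rw [sum_comm]
      exact sum_congr rfl fun x _ => sum_comm
    rw [this]
    have key : ∀ x ∈ X, ∀ y ∈ X, ∑ a ∈ A, χ a x * χ a y ≤
        C + if x = y then (diffRep A x : ℝ) else 0 := by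
      intro x hx y hy
      split_ifs with h
      · subst h
        rw [hr]
        have : ∑ a ∈ A, χ a x * χ a x = ∑ a ∈ A, χ a x :=
          sum_congr rfl fun a _ => by simp [hχ]
        rw [this]
        linarith [(Nat.cast_nonneg C : (0 : ℝ) ≤ C)]
      · have h0 := hC x y (mem_filter.1 hx).2.1 (mem_filter.1 hy).2.1 h
        have : ∑ a ∈ A, χ a x * χ a y = (#{a ∈ A | a + x ∈ A ∧ a + y ∈ A} : ℝ) := by
          simp only [hχ, mul_ite, mul_one, mul_zero, ← ite_and]
          rw [← sum_filter, sum_const, nsmul_eq_mul, mul_one]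
          congr 2
          ext a; simp; tauto
        rw [this, add_zero]
        exact_mod_cast h0
    refine (sum_le_sum fun x hx => sum_le_sum fun y hy => key x hx y hy).trans ?_
    have : ∑ x ∈ X, ∑ y ∈ X, ((C : ℝ) + if x = y then (diffRep A x : ℝ) else 0) =
        S + C * (#X : ℝ) ^ 2 := by
      have hrow : ∀ x ∈ X, ∑ y ∈ X, ((C : ℝ) + if x = y then (diffRep A x : ℝ) else 0) =
          #X * C + diffRep A x := by
        intro x hx
        rw [sum_add_distrib, sum_const, nsmul_eq_mul, sum_ite_eq, if_pos hx]
      rw [sum_congr rfl hrow, sum_add_distrib, sum_const, nsmul_eq_mul, ← hS]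
      ring
    exact this.le
  have h3 : τ * #X ≤ S := by
    rw [hS, mul_comm, ← nsmul_eq_mul, ← sum_const]
    exact sum_le_sum fun x hx => (mem_filter.1 hx).2.2.le
  have hS0 : 0 ≤ S := sum_nonneg fun _ _ => Nat.cast_nonneg _
  have hS2 : S ≤ 2 * #A := by
    have h4 : (4 * C * #A) * (#X : ℝ) ^ 2 ≤ S ^ 2 := by
      calc _ ≤ τ ^ 2 * (#X : ℝ) ^ 2 := by gcongr
        _ = (τ * #X) ^ 2 := by ring
        _ ≤ S ^ 2 := by gcongr
    have h5 : S ^ 2 ≤ #A * (S + C * (#X : ℝ) ^ 2) := h1.trans (by gcongr)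
    rcases hS0.eq_or_lt with h | h
    · rw [← h]; exact mul_nonneg zero_le_two (Nat.cast_nonneg _)
    · have : S * (3 * S) ≤ S * (4 * #A) := by nlinarith
      have := le_of_mul_le_mul_left this h
      linarith
  have hsub : (A - A).filter (fun x => τ < diffRep A x) ⊆ insert 0 X := by
    intro x hx
    simp only [hX, mem_insert, mem_filter] at hx ⊢
    tauto
  calc _ ≤ ∑ x ∈ insert 0 X, (diffRep A x : ℝ) :=
        sum_le_sum_of_subset_of_nonneg hsub fun _ _ _ => Nat.cast_nonneg _
    _ = diffRep A 0 + S := by rw [sum_insert (by simp [hX])]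
    _ ≤ #A + 2 * #A := by
        gcongr
        exact diffRep_le_card A 0
    _ = 3 * #A := by ring

lemma sum_diffRep_eq (A : Finset ℤ) : ∑ x ∈ A - A, (diffRep A x : ℝ) = (#A : ℝ) ^ 2 := by
  have := sum_pairs_eq A (fun _ => 1)
  simp only [sum_const, nsmul_eq_mul, mul_one] at this
  rw [← this, sq]

lemma addEnergy_eq_sum_pairs (A : Finset ℤ) :
    (_root_.addEnergy A : ℝ) = ∑ a ∈ A, ∑ b ∈ A, (diffRep A (a - b) : ℝ) := by
  rw [sum_pairs_eq A (fun x => (diffRep A x : ℝ)), addEnergy_eq]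
  push_cast
  exact sum_congr rfl fun x _ => sq _

lemma addEnergy_pow_three_le (A : Finset ℤ) :
    (_root_.addEnergy A : ℝ) ^ 3 ≤ (#A : ℝ) ^ 3 * ∑ a ∈ A, ∑ b ∈ A, ∑ c ∈ A,
      (diffRep A (a - b) : ℝ) * diffRep A (a - c) * diffRep A (b - c) := by
  set χ : ℤ → ℤ → ℝ := fun a u => if a + u ∈ A then 1 else 0
  have hχ : ∀ a ∈ A, ∀ b, (diffRep A (a - b) : ℝ) = ∑ u ∈ A - A, χ a u * χ b u :=
    fun a ha b => diffRep_sub_eq_sum A ha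
  have h := sum_gram_pow_three_le A (A - A) χ (fun a b => ∑ u ∈ A - A, χ a u * χ b u)
    (fun _ _ => rfl)
  rw [addEnergy_eq_sum_pairs]
  have e1 : ∑ a ∈ A, ∑ b ∈ A, (diffRep A (a - b) : ℝ) =
      ∑ a ∈ A, ∑ b ∈ A, ∑ u ∈ A - A, χ a u * χ b u :=
    sum_congr rfl fun a ha => sum_congr rfl fun b _ => hχ a ha b
  rw [e1]
  refine h.trans (le_of_eq ?_)
  congr 1
  refine sum_congr rfl fun a ha => sum_congr rfl fun b hb => sum_congr rfl fun c _ => ?_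
  rw [hχ a ha b, hχ a ha c, hχ b hb c]

lemma sum_triangle_large_le {A : Finset ℤ} {C : ℕ}
    (hC : ∀ x y : ℤ, x ≠ 0 → y ≠ 0 → x ≠ y → #{a ∈ A | a + x ∈ A ∧ a + y ∈ A} ≤ C)
    {τ : ℝ} (hτ0 : 0 ≤ τ) (hτ : 4 * C * #A ≤ τ ^ 2) :
    ∑ a ∈ A, ∑ b ∈ A, ∑ c ∈ A, (if τ < diffRep A (a - b) then
      (diffRep A (a - b) : ℝ) * diffRep A (a - c) * diffRep A (b - c) else 0) ≤
      3 * (#A : ℝ) ^ 2 * (#A * τ ^ 2 + 3 * (#A : ℝ) ^ 2) := by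
  set n : ℝ := (#A : ℝ) with hn
  have hn0 : 0 ≤ n := Nat.cast_nonneg _
  set L := (A - A).filter (fun x => τ < diffRep A x) with hL
  have hLs : ∑ x ∈ L, (diffRep A x : ℝ) ^ 2 ≤ 3 * n ^ 2 := by
    calc _ ≤ ∑ x ∈ L, n * (diffRep A x : ℝ) := sum_le_sum fun x _ => by
            rw [sq]
            gcongr
            exact Nat.cast_le.2 (diffRep_le_card A x)
      _ = n * ∑ x ∈ L, (diffRep A x : ℝ) := by rw [mul_sum]
      _ ≤ n * (3 * n) := by gcongr; exact sum_diffRep_large_le hC hτ0 hτ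
      _ = _ := by ring
  have hrow : ∀ a ∈ A, ∑ c ∈ A, (diffRep A (a - c) : ℝ) ^ 2 ≤ n * τ ^ 2 + 3 * n ^ 2 := by
    intro a ha
    have h1 : ∀ c ∈ A, (diffRep A (a - c) : ℝ) ^ 2 ≤
        τ ^ 2 + if τ < diffRep A (a - c) then (diffRep A (a - c) : ℝ) ^ 2 else 0 := by
      intro c _
      split_ifs with h
      · linarith [sq_nonneg τ]
      · rw [add_zero]; gcongr; exact not_lt.1 h
    refine (sum_le_sum h1).trans ?_
    rw [sum_add_distrib, sum_const, nsmul_eq_mul, ← sum_filter]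
    refine add_le_add le_rfl (le_trans ?_ hLs)
    rw [← sum_image (s := A.filter fun c => τ < diffRep A (a - c)) (g := fun c => a - c)
      (f := fun x => (diffRep A x : ℝ) ^ 2) (by intro x _ y _ h; simpa using h)]
    refine sum_le_sum_of_subset_of_nonneg ?_ fun _ _ _ => sq_nonneg _
    intro x hx
    obtain ⟨c, hc, rfl⟩ := mem_image.1 hx
    rw [mem_filter] at hc
    exact mem_filter.2 ⟨sub_mem_sub ha hc.1, hc.2⟩
  set G := n * τ ^ 2 + 3 * n ^ 2 with hG
  have hG0 : 0 ≤ G := by positivity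
  have hcs : ∀ a ∈ A, ∀ b ∈ A,
      ∑ c ∈ A, (diffRep A (a - c) : ℝ) * diffRep A (b - c) ≤ G := by
    intro a ha b hb
    have h : ∀ c ∈ A, (diffRep A (a - c) : ℝ) * diffRep A (b - c) ≤
        ((diffRep A (a - c) : ℝ) ^ 2 + (diffRep A (b - c) : ℝ) ^ 2) / 2 := fun c _ => by
      nlinarith [sq_nonneg ((diffRep A (a - c) : ℝ) - diffRep A (b - c))]
    refine (sum_le_sum h).trans ?_
    rw [← sum_div, sum_add_distrib]
    linarith [hrow a ha, hrow b hb]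
  calc _ ≤ ∑ a ∈ A, ∑ b ∈ A, (if τ < diffRep A (a - b) then (diffRep A (a - b) : ℝ) else 0) * G := by
        refine sum_le_sum fun a ha => sum_le_sum fun b hb => ?_
        split_ifs
        · simp only [mul_assoc]
          rw [← mul_sum]
          gcongr
          exact hcs a ha b hb
        · simp
    _ = (∑ x ∈ L, (diffRep A x : ℝ) ^ 2) * G := by
        simp_rw [← sum_mul]
        rw [sum_pairs_eq A (fun x => if τ < diffRep A x then (diffRep A x : ℝ) else 0), hL,
          sum_filter]
        congr 1
        exact sum_congr rfl fun x _ => by split_ifs <;> ring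
    _ ≤ 3 * n ^ 2 * G := by gcongr

/-- Triangles with all three differences in `D` are controlled by their difference patterns. -/
lemma card_triangles_le {A D : Finset ℤ} {C : ℕ}
    (hC : ∀ x y : ℤ, x ≠ 0 → y ≠ 0 → x ≠ y → #{a ∈ A | a + x ∈ A ∧ a + y ∈ A} ≤ C)
    (hD0 : (0 : ℤ) ∉ D) :
    #{p ∈ A ×ˢ A ×ˢ A | p.1 - p.2.1 ∈ D ∧ p.1 - p.2.2 ∈ D ∧ p.2.1 - p.2.2 ∈ D} ≤
      C * #{p ∈ D ×ˢ D | p.1 - p.2 ∈ D} := by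
  refine card_le_mul_card_image_of_maps_to
    (f := fun p : ℤ × ℤ × ℤ => (p.1 - p.2.2, p.2.1 - p.2.2)) ?_ C ?_
  · rintro ⟨a, b, c⟩ h
    simp only [mem_filter, mem_product] at h ⊢
    refine ⟨⟨h.2.2.1, h.2.2.2⟩, ?_⟩
    simpa using h.2.1
  · rintro ⟨x, y⟩ h
    simp only [mem_filter, mem_product] at h
    have hx : x ≠ 0 := fun h0 => hD0 (h0 ▸ h.1.1)
    have hy : y ≠ 0 := fun h0 => hD0 (h0 ▸ h.1.2)
    have hxy : x ≠ y := fun h0 => hD0 (by simpa [h0] using h.2)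
    refine le_trans ?_ (hC x y hx hy hxy)
    refine card_le_card_of_injOn (fun p => p.2.2) ?_ ?_
    · rintro ⟨a, b, c⟩ hp
      simp only [coe_filter, mem_filter, mem_product, Set.mem_ofPred_eq, Prod.mk.injEq] at hp ⊢
      obtain ⟨⟨⟨ha, hb, hc⟩, -⟩, rfl, rfl⟩ := hp
      simp [ha, hb, hc]
    · rintro ⟨a, b, c⟩ hp ⟨a', b', c'⟩ hp' hcc
      simp only [coe_filter, mem_filter, Set.mem_ofPred_eq, Prod.mk.injEq] at hp hp' hcc ⊢
      subst hcc
      refine ⟨?_, ?_, rfl⟩ <;> linarith [hp.2.1, hp.2.2, hp'.2.1, hp'.2.2]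

set_option maxHeartbeats 1000000 in
/-- A set of large energy in which the sets `A ∩ (A - x)` have bounded pairwise intersections has
a set `D` of popular differences which contains a positive proportion of its own differences. -/
lemma exists_popular_differences {A : Finset ℤ} {C : ℕ}
    (hC : ∀ x y : ℤ, x ≠ 0 → y ≠ 0 → x ≠ y → #{a ∈ A | a + x ∈ A ∧ a + y ∈ A} ≤ C)
    {κ s : ℝ} (hκ : 64 ≤ κ) (hCκ : C ≤ κ) (hs : s ^ 2 = #A) (hsκ : κ ^ 7 ≤ s)
    (hE : s ^ 5 ≤ κ * _root_.addEnergy A) :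
    ∃ D : Finset ℤ, (∀ x ∈ D, s ≤ κ ^ 6 * diffRep A x) ∧ #D ≤ κ ^ 6 * s ^ 3 ∧
      s ^ 6 ≤ κ ^ 9 * #{p ∈ D ×ˢ D | p.1 - p.2 ∈ D} := by
  have hκ0 : 0 < κ := by linarith
  have hs0 : 0 < s := lt_of_lt_of_le (by positivity) hsκ
  set τ := 2 * κ * s with hτ
  have hτ0 : 0 < τ := by positivity
  have hCn : 4 * C * #A ≤ τ ^ 2 := by
    rw [← hs, hτ]
    have : (C : ℝ) ≤ κ ^ 2 := hCκ.trans (by nlinarith)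
    calc 4 * (C : ℝ) * s ^ 2 ≤ 4 * κ ^ 2 * s ^ 2 := by gcongr
      _ = _ := by ring
  set r : ℤ → ℝ := fun x => (diffRep A x : ℝ) with hr
  have hr0 : ∀ x, 0 ≤ r x := fun x => Nat.cast_nonneg _
  have hrneg : ∀ x y, r (x - y) = r (y - x) := fun x y => by
    simp only [hr]; rw [← diffRep_neg, neg_sub]
  set D := (A - A).filter (fun x => s ≤ κ ^ 6 * r x ∧ r x ≤ τ) with hD
  set tri := (A ×ˢ A ×ˢ A).filter
    (fun p => p.1 - p.2.1 ∈ D ∧ p.1 - p.2.2 ∈ D ∧ p.2.1 - p.2.2 ∈ D) with htri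
  refine ⟨D, fun x hx => (mem_filter.1 hx).2.1, ?_, ?_⟩
  · have h1 : ∑ x ∈ D, s ≤ ∑ x ∈ A - A, κ ^ 6 * r x :=
      (sum_le_sum fun x hx => (mem_filter.1 hx).2.1).trans
        (sum_le_sum_of_subset_of_nonneg (filter_subset _ _) fun x _ _ =>
          mul_nonneg (by positivity) (hr0 x))
    rw [← mul_sum, sum_diffRep_eq, sum_const, nsmul_eq_mul, ← hs] at h1
    have : (#D : ℝ) * s ≤ (κ ^ 6 * s ^ 3) * s := h1.trans_eq (by ring)
    exact le_of_mul_le_mul_right this hs0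
  set T := ∑ a ∈ A, ∑ b ∈ A, ∑ c ∈ A, r (a - b) * r (a - c) * r (b - c) with hT
  have hTlow : s ^ 9 ≤ κ ^ 3 * T := by
    have h := addEnergy_pow_three_le A
    rw [← hs] at h
    have h15 : s ^ 6 * s ^ 9 ≤ s ^ 6 * (κ ^ 3 * T) := by
      calc s ^ 6 * s ^ 9 = (s ^ 5) ^ 3 := by ring
        _ ≤ (κ * _root_.addEnergy A) ^ 3 := by gcongr
        _ = κ ^ 3 * (_root_.addEnergy A : ℝ) ^ 3 := by ring
        _ ≤ κ ^ 3 * ((s ^ 2) ^ 3 * T) := by gcongr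
        _ = _ := by ring
    exact le_of_mul_le_mul_left h15 (by positivity)
  have hbig := sum_triangle_large_le hC hτ0.le hCn
  rw [← hs] at hbig
  set S1 := ∑ a ∈ A, ∑ b ∈ A, ∑ c ∈ A,
    (if τ < r (a - b) then r (a - b) * r (a - c) * r (b - c) else 0) with hS1
  have hS2 : ∑ a ∈ A, ∑ b ∈ A, ∑ c ∈ A,
      (if τ < r (a - c) then r (a - b) * r (a - c) * r (b - c) else 0) = S1 := by
    refine sum_congr rfl fun a _ => ?_
    rw [sum_comm]
    refine sum_congr rfl fun b _ => sum_congr rfl fun c _ => ?_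
    rw [hrneg c b]
    split_ifs <;> ring
  have hS3 : ∑ a ∈ A, ∑ b ∈ A, ∑ c ∈ A,
      (if τ < r (b - c) then r (a - b) * r (a - c) * r (b - c) else 0) = S1 := by
    rw [sum_comm]
    refine sum_congr rfl fun b _ => ?_
    rw [sum_comm]
    refine sum_congr rfl fun c _ => sum_congr rfl fun a _ => ?_
    rw [hrneg a b, hrneg a c]
    split_ifs <;> ring
  have hsmall : T ≤ S1 + S1 + S1 + s ^ 6 * (s / κ ^ 6 * τ ^ 2) + τ ^ 3 * #tri := by
    have hpt : ∀ a ∈ A, ∀ b ∈ A, ∀ c ∈ A, r (a - b) * r (a - c) * r (b - c) ≤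
        (if τ < r (a - b) then r (a - b) * r (a - c) * r (b - c) else 0) +
        (if τ < r (a - c) then r (a - b) * r (a - c) * r (b - c) else 0) +
        (if τ < r (b - c) then r (a - b) * r (a - c) * r (b - c) else 0) +
        s / κ ^ 6 * τ ^ 2 +
        τ ^ 3 * (if a - b ∈ D ∧ a - c ∈ D ∧ b - c ∈ D then 1 else 0) := by
      intro a ha b hb c hc
      have hnn : 0 ≤ r (a - b) * r (a - c) * r (b - c) :=
        mul_nonneg (mul_nonneg (hr0 _) (hr0 _)) (hr0 _)
      have hδ : 0 ≤ s / κ ^ 6 * τ ^ 2 := by positivity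
      have hlast : 0 ≤ τ ^ 3 * (if a - b ∈ D ∧ a - c ∈ D ∧ b - c ∈ D then (1 : ℝ) else 0) := by
        split_ifs <;> positivity
      have hi1 : 0 ≤ if τ < r (a - b) then r (a - b) * r (a - c) * r (b - c) else 0 := by
        split_ifs <;> simp [hnn]
      have hi2 : 0 ≤ if τ < r (a - c) then r (a - b) * r (a - c) * r (b - c) else 0 := by
        split_ifs <;> simp [hnn]
      have hi3 : 0 ≤ if τ < r (b - c) then r (a - b) * r (a - c) * r (b - c) else 0 := by
        split_ifs <;> simp [hnn]
      by_cases h1 : τ < r (a - b)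
      · rw [if_pos h1] at hi1 ⊢; linarith
      by_cases h2 : τ < r (a - c)
      · rw [if_pos h2] at hi2 ⊢; linarith
      by_cases h3 : τ < r (b - c)
      · rw [if_pos h3] at hi3 ⊢; linarith
      rw [not_lt] at h1 h2 h3
      suffices hmain : r (a - b) * r (a - c) * r (b - c) ≤ s / κ ^ 6 * τ ^ 2 +
          τ ^ 3 * (if a - b ∈ D ∧ a - c ∈ D ∧ b - c ∈ D then 1 else 0) by linarith
      have hτ' : ∀ {x y z : ℝ}, 0 ≤ x → 0 ≤ y → 0 ≤ z → x ≤ s / κ ^ 6 → y ≤ τ → z ≤ τ →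
          x * y * z ≤ s / κ ^ 6 * τ ^ 2 := by
        intro x y z hx hy hz h1 h2 h3
        calc x * y * z ≤ s / κ ^ 6 * τ * τ := by gcongr
          _ = _ := by ring
      have hmemD : ∀ {x}, x ∈ A - A → r x ≤ τ → x ∉ D → r x ≤ s / κ ^ 6 := by
        intro x hx hxτ hxD
        rw [le_div_iff₀ (by positivity), mul_comm]
        by_contra hcon
        exact hxD (mem_filter.2 ⟨hx, (not_le.1 hcon).le, hxτ⟩)
      by_cases hd1 : a - b ∈ D
      · by_cases hd2 : a - c ∈ D
        · by_cases hd3 : b - c ∈ D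
          · rw [if_pos ⟨hd1, hd2, hd3⟩]
            have : r (a - b) * r (a - c) * r (b - c) ≤ τ * τ * τ := by
              gcongr
            nlinarith
          · have := hτ' (hr0 _) (hr0 _) (hr0 _) (hmemD (sub_mem_sub hb hc) h3 hd3) h1 h2
            linarith [mul_comm (r (b - c)) (r (a - b)), mul_comm (r (b - c) * r (a - b)) (r (a - c)),
              mul_comm (r (a - b) * r (a - c)) (r (b - c)), mul_assoc (r (b - c)) (r (a - b)) (r (a - c))]
        · have := hτ' (hr0 _) (hr0 _) (hr0 _) (hmemD (sub_mem_sub ha hc) h2 hd2) h1 h3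
          linarith [mul_comm (r (a - c)) (r (a - b))]
      · have := hτ' (hr0 _) (hr0 _) (hr0 _) (hmemD (sub_mem_sub ha hb) h1 hd1) h2 h3
        linarith
    have hsum := sum_le_sum fun a ha => sum_le_sum fun b hb => sum_le_sum fun c hc =>
      hpt a ha b hb c hc
    simp only [sum_add_distrib, ← mul_sum] at hsum
    rw [hS2, hS3] at hsum
    refine hsum.trans (le_of_eq ?_)
    have hcount : ∑ a ∈ A, ∑ b ∈ A, ∑ c ∈ A,
        (if a - b ∈ D ∧ a - c ∈ D ∧ b - c ∈ D then (1 : ℝ) else 0) = #tri := by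
      rw [htri, card_filter, Nat.cast_sum, sum_product]
      simp only [sum_product, Nat.cast_ite, Nat.cast_one, Nat.cast_zero]
    rw [hcount]
    simp only [sum_const, nsmul_eq_mul]
    rw [← hs]
    ring
  have htrilow : s ^ 6 ≤ 16 * κ ^ 6 * #tri := by
    have hS1b : 3 * S1 * κ ^ 3 ≤ s ^ 9 / 4 := by
      have : S1 ≤ 21 * κ ^ 2 * s ^ 8 := by
        refine hbig.trans ?_
        rw [hτ]
        have : s ^ 8 * 9 ≤ s ^ 8 * (9 * κ ^ 2) := by gcongr; nlinarith
        nlinarith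
      have h2 : 252 * κ ^ 5 * s ^ 8 ≤ s * s ^ 8 := by
        gcongr
        refine le_trans ?_ hsκ
        have : 252 ≤ κ ^ 2 := by nlinarith
        calc 252 * κ ^ 5 ≤ κ ^ 2 * κ ^ 5 := by gcongr
          _ = κ ^ 7 := by ring
      have h3 : 3 * S1 * κ ^ 3 ≤ 3 * (21 * κ ^ 2 * s ^ 8) * κ ^ 3 := by gcongr
      nlinarith
    have hmid : s ^ 6 * (s / κ ^ 6 * τ ^ 2) * κ ^ 3 ≤ s ^ 9 / 4 := by
      have : s ^ 6 * (s / κ ^ 6 * τ ^ 2) * κ ^ 3 = 4 * s ^ 9 / κ := by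
        rw [hτ]; field_simp; ring
      rw [this, div_le_div_iff₀ hκ0 (by norm_num)]
      have : 0 < s ^ 9 := by positivity
      nlinarith
    have hfin : s ^ 9 ≤ s ^ 9 / 4 + s ^ 9 / 4 + κ ^ 3 * τ ^ 3 * #tri := by
      have := mul_le_mul_of_nonneg_left hsmall (by positivity : 0 ≤ κ ^ 3)
      nlinarith
    have : s ^ 3 * s ^ 6 ≤ s ^ 3 * (16 * κ ^ 6 * #tri) := by
      rw [hτ] at hfin
      nlinarith
    exact le_of_mul_le_mul_left this (by positivity)
  have hD0 : (0 : ℤ) ∉ D := by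
    intro h
    have h1 := (mem_filter.1 h).2.2
    have h2 : r 0 = s ^ 2 := by simp [hr, diffRep, hs]
    rw [h2, hτ] at h1
    have : s ≤ 2 * κ := by nlinarith
    have : κ ^ 7 ≤ 2 * κ := hsκ.trans this
    have h6 : (64 : ℝ) ^ 6 ≤ κ ^ 6 := by gcongr
    nlinarith
  have hmap : (#tri : ℝ) ≤ C * #{p ∈ D ×ˢ D | p.1 - p.2 ∈ D} := by
    have : #tri ≤ C * #{p ∈ D ×ˢ D | p.1 - p.2 ∈ D} := card_triangles_le hC hD0
    exact_mod_cast this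
  calc s ^ 6 ≤ 16 * κ ^ 6 * #tri := htrilow
    _ ≤ κ ^ 2 * κ ^ 6 * (κ * #{p ∈ D ×ˢ D | p.1 - p.2 ∈ D}) := by
        gcongr
        · nlinarith
        · exact hmap.trans (by gcongr)
    _ = _ := by ring

/-- The number of common neighbours of `x` and `x'` in the bipartite difference graph of `D`. -/
def codeg (D : Finset ℤ) (x x' : ℤ) : ℕ := #{y ∈ D | x - y ∈ D ∧ x' - y ∈ D}

lemma codeg_comm (D : Finset ℤ) (x x' : ℤ) : codeg D x x' = codeg D x' x := by
  simp only [codeg, and_comm]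

/-- Counting paths of length two through a set `Y` gives many representations of `x - x'`. -/
lemma sum_codeg_mul_codeg_le (D Y : Finset ℤ) (x x' : ℤ) :
    ∑ w ∈ Y, codeg D x w * codeg D w x' ≤
      #{d ∈ D ×ˢ D ×ˢ D ×ˢ D | d.1 - d.2.1 + d.2.2.1 - d.2.2.2 = x - x'} := by
  have h : ∑ w ∈ Y, codeg D x w * codeg D w x' = #(Y.sigma fun w =>
      {y ∈ D | x - y ∈ D ∧ w - y ∈ D} ×ˢ {y ∈ D | w - y ∈ D ∧ x' - y ∈ D}) := by
    rw [card_sigma]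
    exact sum_congr rfl fun w _ => by rw [card_product]; rfl
  rw [h]
  refine card_le_card_of_injOn
    (fun p => (x - p.2.1, p.1 - p.2.1, p.1 - p.2.2, x' - p.2.2)) ?_ ?_
  · rintro ⟨w, y, y'⟩ hp
    simp only [coe_sigma, Set.mem_sigma_iff, mem_coe, mem_product, mem_filter] at hp
    simp only [coe_filter, mem_product, Set.mem_ofPred_eq]
    refine ⟨⟨hp.2.1.2.1, hp.2.1.2.2, hp.2.2.2.1, hp.2.2.2.2⟩, by ring⟩
  · rintro ⟨w, y, y'⟩ _ ⟨v, z, z'⟩ _ hpq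
    simp only [Prod.mk.injEq] at hpq
    obtain ⟨h1, h2, -, h4⟩ := hpq
    obtain rfl : y = z := by linarith
    obtain rfl : y' = z' := by linarith
    obtain rfl : w = v := by linarith
    rfl

lemma sum_card_neighbors (D : Finset ℤ) :
    ∑ y ∈ D, #{x ∈ D | x - y ∈ D} = #{p ∈ D ×ˢ D | p.1 - p.2 ∈ D} := by
  rw [card_filter, sum_product_right]
  simp only [card_filter]

lemma sum_card_pairs_eq_sum_codeg (D : Finset ℤ) (P : ℤ × ℤ → Prop) [DecidablePred P] :
    ∑ y ∈ D, #{p ∈ {x ∈ D | x - y ∈ D} ×ˢ {x ∈ D | x - y ∈ D} | P p} =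
      ∑ p ∈ (D ×ˢ D).filter P, codeg D p.1 p.2 := by
  simp only [codeg, card_filter]
  rw [sum_comm' (t' := D) (s' := fun _ => (D ×ˢ D).filter P) (by tauto)]
  refine sum_congr rfl fun y _ => ?_
  rw [← card_filter, ← card_filter]
  congr 1
  ext p
  simp only [mem_filter, mem_product]
  tauto

/-- Choosing a neighbourhood almost all of whose pairs have many common neighbours. -/
lemma exists_neighbors_few_bad {D : Finset ℤ} (hDne : D.Nonempty) {K : ℝ} (hK : 1 ≤ K)
    (hG : (#D : ℝ) ^ 2 ≤ K * #{p ∈ D ×ˢ D | p.1 - p.2 ∈ D}) :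
    ∃ X ⊆ D, (#D : ℝ) ^ 2 ≤ 2 * K ^ 2 * (#X : ℝ) ^ 2 ∧
      8 * (#{p ∈ X ×ˢ X | 16 * K ^ 2 * codeg D p.1 p.2 < #D} : ℝ) ≤ (#X : ℝ) ^ 2 := by
  set N : ℝ := (#D : ℝ) with hN
  have hN0 : 0 < N := by rw [hN]; exact_mod_cast hDne.card_pos
  have hK0 : 0 < K := by linarith
  set X : ℤ → Finset ℤ := fun y => {x ∈ D | x - y ∈ D} with hX
  set bad : ℤ → ℝ := fun y => (#{p ∈ X y ×ˢ X y | 16 * K ^ 2 * codeg D p.1 p.2 < N} : ℝ) with hbad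
  have h1 : N ^ 3 / K ^ 2 ≤ ∑ y ∈ D, (#(X y) : ℝ) ^ 2 := by
    have hcs : (∑ y ∈ D, (#(X y) : ℝ)) ^ 2 ≤ N * ∑ y ∈ D, (#(X y) : ℝ) ^ 2 :=
      sq_sum_le_card_mul_sum_sq
    have hsum : ∑ y ∈ D, (#(X y) : ℝ) = #{p ∈ D ×ˢ D | p.1 - p.2 ∈ D} := by
      rw [← sum_card_neighbors]; push_cast; rfl
    rw [hsum] at hcs
    rw [div_le_iff₀ (by positivity)]
    have : N * N ^ 3 ≤ N * ((∑ y ∈ D, (#(X y) : ℝ) ^ 2) * K ^ 2) := by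
      calc N * N ^ 3 = (N ^ 2) ^ 2 := by ring
        _ ≤ (K * #{p ∈ D ×ˢ D | p.1 - p.2 ∈ D}) ^ 2 := by gcongr
        _ = K ^ 2 * (#{p ∈ D ×ˢ D | p.1 - p.2 ∈ D} : ℝ) ^ 2 := by ring
        _ ≤ K ^ 2 * (N * ∑ y ∈ D, (#(X y) : ℝ) ^ 2) := by gcongr
        _ = _ := by ring
    exact le_of_mul_le_mul_left this hN0
  have h2 : ∑ y ∈ D, bad y ≤ N ^ 3 / (16 * K ^ 2) := by
    have e := sum_card_pairs_eq_sum_codeg D (fun p => 16 * K ^ 2 * codeg D p.1 p.2 < N)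
    have e' : ∑ y ∈ D, bad y = ∑ p ∈ (D ×ˢ D).filter (fun p => 16 * K ^ 2 * codeg D p.1 p.2 < N),
        (codeg D p.1 p.2 : ℝ) := by
      rw [hbad, ← Nat.cast_sum, ← Nat.cast_sum, ← e]
    rw [e']
    have hle : ∀ p ∈ (D ×ˢ D).filter (fun p => 16 * K ^ 2 * codeg D p.1 p.2 < N),
        (codeg D p.1 p.2 : ℝ) ≤ N / (16 * K ^ 2) := by
      intro p hp
      rw [le_div_iff₀ (by positivity)]
      linarith [(mem_filter.1 hp).2]
    refine (sum_le_card_nsmul _ _ _ hle).trans ?_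
    rw [nsmul_eq_mul]
    have : (#((D ×ˢ D).filter (fun p => 16 * K ^ 2 * codeg D p.1 p.2 < N)) : ℝ) ≤ N ^ 2 := by
      refine (Nat.cast_le.2 (card_filter_le _ _)).trans (le_of_eq ?_)
      rw [card_product, Nat.cast_mul, hN, sq]
    calc _ ≤ N ^ 2 * (N / (16 * K ^ 2)) := by gcongr
      _ = _ := by ring
  have h3 : ∑ _y ∈ D, N ^ 2 / (2 * K ^ 2) ≤ ∑ y ∈ D, ((#(X y) : ℝ) ^ 2 - 8 * bad y) := by
    rw [sum_sub_distrib, ← mul_sum, sum_const, nsmul_eq_mul, ← hN]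
    have e1 : N * (N ^ 2 / (2 * K ^ 2)) = N ^ 3 / K ^ 2 - 8 * (N ^ 3 / (16 * K ^ 2)) := by
      field_simp; ring
    rw [e1]
    linarith
  obtain ⟨y, -, hy⟩ := exists_le_of_sum_le hDne h3
  have hb0 : 0 ≤ bad y := Nat.cast_nonneg _
  have hp0 : 0 ≤ N ^ 2 / (2 * K ^ 2) := by positivity
  refine ⟨X y, filter_subset _ _, ?_, by linarith⟩
  have : N ^ 2 / (2 * K ^ 2) ≤ (#(X y) : ℝ) ^ 2 := by linarith
  rw [div_le_iff₀ (by positivity)] at this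
  linarith

/-- A Balog–Szemerédi–Gowers statement: a set containing many of its own differences has a large
subset of small doubling. -/
lemma exists_small_doubling {D : Finset ℤ} (hDne : D.Nonempty) {K : ℝ} (hK : 1 ≤ K)
    (hG : (#D : ℝ) ^ 2 ≤ K * #{p ∈ D ×ˢ D | p.1 - p.2 ∈ D}) :
    ∃ B ⊆ D, (#D : ℝ) ≤ 4 * K * #B ∧ (#(B - B) : ℝ) ≤ 2048 * K ^ 6 * #B := by
  obtain ⟨X, hXD, hX, hbad⟩ := exists_neighbors_few_bad hDne hK hG
  set N : ℝ := (#D : ℝ) with hN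
  have hN0 : 0 < N := by rw [hN]; exact_mod_cast hDne.card_pos
  have hK0 : 0 < K := by linarith
  have hX0 : 0 < (#X : ℝ) := by
    rcases (Nat.cast_nonneg #X : (0 : ℝ) ≤ #X).eq_or_lt with h | h
    · rw [← h] at hX; nlinarith
    · exact h
  set nb : ℤ → Finset ℤ := fun x => {x' ∈ X | 16 * K ^ 2 * codeg D x x' < N} with hnb
  set B := X.filter (fun x => 4 * #(nb x) ≤ #X) with hB
  have hBX : (#X : ℝ) ≤ 2 * #B := by
    have h1 : (#(X.filter fun x => ¬ 4 * #(nb x) ≤ #X) : ℝ) * (#X : ℝ) ≤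
        4 * #{p ∈ X ×ˢ X | 16 * K ^ 2 * codeg D p.1 p.2 < N} := by
      rw [card_filter _ (X ×ˢ X), sum_product]
      push_cast
      have : ∀ x ∈ X.filter fun x => ¬ 4 * #(nb x) ≤ #X, (#X : ℝ) ≤
          4 * ∑ y ∈ X, if 16 * K ^ 2 * codeg D x y < N then (1 : ℝ) else 0 := by
        intro x hx
        have h := (mem_filter.1 hx).2
        rw [not_le] at h
        have h' : (#X : ℝ) < 4 * #(nb x) := by exact_mod_cast h
        rw [hnb, card_filter] at h'
        push_cast at h'
        exact h'.le
      rw [← nsmul_eq_mul, ← sum_const, mul_sum]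
      refine (sum_le_sum this).trans ?_
      refine sum_le_sum_of_subset_of_nonneg (filter_subset _ _) fun _ _ _ => ?_
      positivity
    have h2 : (#B : ℝ) + #(X.filter fun x => ¬ 4 * #(nb x) ≤ #X) = #X := by
      rw [hB, ← Nat.cast_add]
      exact_mod_cast card_filter_add_card_filter_not (fun x => 4 * #(nb x) ≤ #X)
    have h3 : (#(X.filter fun x => ¬ 4 * #(nb x) ≤ #X) : ℝ) * (#X : ℝ) ≤ (#X / 2) * (#X : ℝ) := by
      linarith
    have h4 := le_of_mul_le_mul_right h3 hX0
    linarith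
  have hNX : N ≤ 2 * K * #X := by
    have : N ^ 2 ≤ (2 * K * #X) ^ 2 := by nlinarith [sq_nonneg (K * #X)]
    exact le_of_sq_le_sq this (by positivity)
  refine ⟨B, (filter_subset _ _).trans hXD, by nlinarith, ?_⟩
  have hrep : ∀ z ∈ B - B, (#X : ℝ) / 2 * (N / (16 * K ^ 2)) ^ 2 ≤
      #{d ∈ D ×ˢ D ×ˢ D ×ˢ D | d.1 - d.2.1 + d.2.2.1 - d.2.2.2 = z} := by
    intro z hz
    obtain ⟨x, hx, x', hx', rfl⟩ := mem_sub.1 hz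
    set Y := X \ (nb x ∪ nb x') with hY
    have hYc : (#X : ℝ) / 2 ≤ #Y := by
      have h1 : #X ≤ #Y + #(nb x ∪ nb x') := by
        rw [hY]; have := le_card_sdiff (nb x ∪ nb x') X; omega
      have h2 := card_union_le (nb x) (nb x')
      have h3 := (mem_filter.1 hx).2
      have h4 := (mem_filter.1 hx').2
      have : #X ≤ 2 * #Y := by omega
      have : (#X : ℝ) ≤ 2 * #Y := by exact_mod_cast this
      linarith
    have hc : ∀ w ∈ Y, (N / (16 * K ^ 2)) ^ 2 ≤ ((codeg D x w * codeg D w x' : ℕ) : ℝ) := by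
      intro w hw
      rw [hY, mem_sdiff, mem_union, not_or] at hw
      have h1 : N / (16 * K ^ 2) ≤ codeg D x w := by
        rw [div_le_iff₀ (by positivity)]
        by_contra hcon
        exact hw.2.1 (mem_filter.2 ⟨hw.1, by linarith⟩)
      have h2 : N / (16 * K ^ 2) ≤ codeg D w x' := by
        rw [div_le_iff₀ (by positivity), codeg_comm]
        by_contra hcon
        exact hw.2.2 (mem_filter.2 ⟨hw.1, by linarith⟩)
      push_cast
      rw [sq]
      gcongr
    calc (#X : ℝ) / 2 * (N / (16 * K ^ 2)) ^ 2 ≤ #Y * (N / (16 * K ^ 2)) ^ 2 := by gcongr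
      _ ≤ ∑ w ∈ Y, ((codeg D x w * codeg D w x' : ℕ) : ℝ) := by
          rw [← nsmul_eq_mul]; exact card_nsmul_le_sum _ _ _ hc
      _ ≤ _ := by exact_mod_cast sum_codeg_mul_codeg_le D Y x x'
  have htot : ∑ z ∈ B - B, (#{d ∈ D ×ˢ D ×ˢ D ×ˢ D | d.1 - d.2.1 + d.2.2.1 - d.2.2.2 = z} : ℝ) ≤
      N ^ 4 := by
    have h1 : ∑ z ∈ B - B, #{d ∈ D ×ˢ D ×ˢ D ×ˢ D | d.1 - d.2.1 + d.2.2.1 - d.2.2.2 = z} ≤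
        #(D ×ˢ D ×ˢ D ×ˢ D) := by
      rw [sum_card_fiberwise_eq_card_filter]; exact card_filter_le _ _
    simp only [card_product] at h1
    have h2 : ∑ z ∈ B - B, (#{d ∈ D ×ˢ D ×ˢ D ×ˢ D | d.1 - d.2.1 + d.2.2.1 - d.2.2.2 = z} : ℝ) ≤
      (#D * (#D * (#D * #D)) : ℕ) := by exact_mod_cast h1
    refine h2.trans (le_of_eq ?_)
    push_cast; ring
  have hfin : (#(B - B) : ℝ) * ((#X : ℝ) / 2 * (N / (16 * K ^ 2)) ^ 2) ≤ N ^ 4 := by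
    rw [← nsmul_eq_mul]
    exact (card_nsmul_le_sum _ _ _ hrep).trans htot
  have e : (#(B - B) : ℝ) * ((#X : ℝ) / 2 * (N / (16 * K ^ 2)) ^ 2) =
      (#(B - B) * #X) * N ^ 2 / (512 * K ^ 4) := by field_simp; ring
  rw [e, div_le_iff₀ (by positivity)] at hfin
  have h5 : (#(B - B) * #X : ℝ) * N ^ 2 ≤ (1024 * K ^ 6 * #X * #X) * N ^ 2 := by
    refine hfin.trans ?_
    calc N ^ 4 * (512 * K ^ 4) = N ^ 2 * (512 * K ^ 4) * N ^ 2 := by ring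
      _ ≤ (2 * K ^ 2 * (#X : ℝ) ^ 2) * (512 * K ^ 4) * N ^ 2 := by gcongr
      _ = _ := by ring
  have h6 := le_of_mul_le_mul_right (le_of_mul_le_mul_right h5 (by positivity)) hX0
  calc (#(B - B) : ℝ) ≤ 1024 * K ^ 6 * #X := h6
    _ ≤ 1024 * K ^ 6 * (2 * #B) := by gcongr
    _ = _ := by ring

/-- A one-sided Chernoff bound for tuples drawn from a finite set. -/
lemma card_sum_large_le {B : Finset ℤ} {g : ℤ → ℝ} (hg : ∀ b ∈ B, |g b| ≤ 1)
    (hsum : ∑ b ∈ B, g b = 0) (m : ℕ) {ε : ℝ} (hε0 : 0 ≤ ε) (hε1 : ε ≤ 1) :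
    (#{y ∈ Fintype.piFinset (fun _ : Fin m => B) | ε * m < ∑ i, g (y i)} : ℝ) ≤
      (#B : ℝ) ^ m * Real.exp (-(ε ^ 2 * m / 4)) := by
  set θ := ε / 2 with hθ
  have hmgf : ∑ b ∈ B, Real.exp (θ * g b) ≤ #B * Real.exp (θ ^ 2) := by
    have h1 : ∀ b ∈ B, Real.exp (θ * g b) ≤ 1 + θ * g b + θ ^ 2 := by
      intro b hb
      have hb1 : |θ * g b| ≤ 1 := by
        rw [abs_mul, abs_of_nonneg (by positivity)]
        nlinarith [hg b hb, abs_nonneg (g b)]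
      have h2 := (abs_le.1 (Real.abs_exp_sub_one_sub_id_le hb1)).2
      have h3 : (θ * g b) ^ 2 ≤ θ ^ 2 := by
        rw [mul_pow]
        have : g b ^ 2 ≤ 1 := (sq_le_one_iff_abs_le_one _).2 (hg b hb)
        nlinarith [sq_nonneg θ]
      linarith
    calc ∑ b ∈ B, Real.exp (θ * g b) ≤ ∑ b ∈ B, (1 + θ * g b + θ ^ 2) := sum_le_sum h1
      _ = #B * (θ ^ 2 + 1) := by
          simp only [sum_add_distrib, sum_const, nsmul_eq_mul, ← mul_sum, hsum]; ring
      _ ≤ #B * Real.exp (θ ^ 2) := by gcongr; exact Real.add_one_le_exp _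
  have htot : ∑ y ∈ Fintype.piFinset (fun _ : Fin m => B), Real.exp (θ * ∑ i, g (y i)) ≤
      (#B : ℝ) ^ m * Real.exp (θ ^ 2 * m) := by
    have e : ∑ y ∈ Fintype.piFinset (fun _ : Fin m => B), Real.exp (θ * ∑ i, g (y i)) =
        (∑ b ∈ B, Real.exp (θ * g b)) ^ m := by
      simp only [mul_sum, Real.exp_sum]
      rw [← prod_univ_sum (fun _ : Fin m => B) (fun _ b => Real.exp (θ * g b))]
      simp
    rw [e]
    calc _ ≤ (#B * Real.exp (θ ^ 2)) ^ m := by gcongr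
      _ = _ := by rw [mul_pow, ← Real.exp_nat_mul, mul_comm (m : ℝ)]
  have hlow : (#{y ∈ Fintype.piFinset (fun _ : Fin m => B) | ε * m < ∑ i, g (y i)} : ℝ) *
      Real.exp (θ * (ε * m)) ≤
      ∑ y ∈ Fintype.piFinset (fun _ : Fin m => B), Real.exp (θ * ∑ i, g (y i)) := by
    rw [← nsmul_eq_mul, ← sum_const]
    refine (sum_le_sum fun y hy => ?_).trans (sum_le_sum_of_subset_of_nonneg (filter_subset _ _)
      fun _ _ _ => (Real.exp_pos _).le)
    have := (mem_filter.1 hy).2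
    gcongr
  have h := hlow.trans htot
  rw [← le_div_iff₀ (Real.exp_pos _), mul_div_assoc, ← Real.exp_sub] at h
  refine h.trans (le_of_eq ?_)
  congr 2
  rw [hθ]; ring

/-- The two-sided bound for the deviation of a sample average. -/
lemma card_abs_sum_large_le {B : Finset ℤ} {g : ℤ → ℝ} (hg : ∀ b ∈ B, |g b| ≤ 1)
    (hsum : ∑ b ∈ B, g b = 0) (m : ℕ) {ε : ℝ} (hε0 : 0 ≤ ε) (hε1 : ε ≤ 1) :
    (#{y ∈ Fintype.piFinset (fun _ : Fin m => B) | ε * m < |∑ i, g (y i)|} : ℝ) ≤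
      2 * ((#B : ℝ) ^ m * Real.exp (-(ε ^ 2 * m / 4))) := by
  have h1 := card_sum_large_le hg hsum m hε0 hε1
  have h2 := card_sum_large_le (g := fun b => -g b) (by simpa using hg)
    (by rw [sum_neg_distrib, hsum, neg_zero]) m hε0 hε1
  have hsub : {y ∈ Fintype.piFinset (fun _ : Fin m => B) | ε * m < |∑ i, g (y i)|} ⊆
      {y ∈ Fintype.piFinset (fun _ : Fin m => B) | ε * m < ∑ i, g (y i)} ∪
      {y ∈ Fintype.piFinset (fun _ : Fin m => B) | ε * m < ∑ i, -g (y i)} := by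
    intro y hy
    simp only [mem_union, mem_filter, sum_neg_distrib, lt_abs] at hy ⊢
    tauto
  have h3 : (#{y ∈ Fintype.piFinset (fun _ : Fin m => B) | ε * m < |∑ i, g (y i)|} : ℝ) ≤
      (#{y ∈ Fintype.piFinset (fun _ : Fin m => B) | ε * m < ∑ i, g (y i)} : ℝ) +
      (#{y ∈ Fintype.piFinset (fun _ : Fin m => B) | ε * m < ∑ i, -g (y i)} : ℝ) := by
    exact_mod_cast (card_le_card hsub).trans (card_union_le _ _)
  linarith

/-- `t` is an almost period of `f` up to `ε`, outside a set of at most `ε N` points. -/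
def AlmostPeriod (f : ℤ → ℝ) (N ε : ℝ) (t : ℤ) : Prop :=
  ∃ E : Finset ℤ, (#E : ℝ) ≤ ε * N ∧ ∀ x ∉ E, |f (x + t) - f x| ≤ ε

lemma AlmostPeriod.zero (f : ℤ → ℝ) (N : ℝ) : AlmostPeriod f N 0 0 :=
  ⟨∅, by simp, by simp⟩

lemma AlmostPeriod.mono {f : ℤ → ℝ} {N ε δ : ℝ} {t : ℤ} (hN : 0 ≤ N) (hεδ : ε ≤ δ)
    (h : AlmostPeriod f N ε t) : AlmostPeriod f N δ t := by
  obtain ⟨E, hE, hf⟩ := h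
  exact ⟨E, hE.trans (by gcongr), fun x hx => (hf x hx).trans hεδ⟩

lemma AlmostPeriod.add {f : ℤ → ℝ} {N ε δ : ℝ} {t u : ℤ} (ht : AlmostPeriod f N ε t)
    (hu : AlmostPeriod f N δ u) : AlmostPeriod f N (ε + δ) (t + u) := by
  obtain ⟨E, hE, hEf⟩ := ht
  obtain ⟨G, hG, hGf⟩ := hu
  refine ⟨E.image (fun x => x - u) ∪ G, ?_, fun x hx => ?_⟩
  · have h1 : (#(E.image (fun x => x - u) ∪ G) : ℝ) ≤ (#E : ℝ) + #G := by
      exact_mod_cast (card_union_le _ _).trans (Nat.add_le_add_right card_image_le _)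
    linarith
  · rw [mem_union, not_or] at hx
    have h1 : x + u ∉ E := fun h => hx.1 (mem_image.2 ⟨x + u, h, by ring⟩)
    have h2 := hEf _ h1
    have h3 := hGf _ hx.2
    have e : x + (t + u) = x + u + t := by ring
    rw [e]
    calc |f (x + u + t) - f x| = |(f (x + u + t) - f (x + u)) + (f (x + u) - f x)| := by ring_nf
      _ ≤ _ := (abs_add_le _ _).trans (add_le_add h2 h3)

/-- Binary expansion: multiples of a number all of whose doublings are almost periods. -/
lemma AlmostPeriod.mul_of_two_pow {f : ℤ → ℝ} {N ε : ℝ} (hN : 0 ≤ N) (hε : 0 ≤ ε) {u : ℤ} (J : ℕ)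
    (h : ∀ j < J, AlmostPeriod f N ε (2 ^ j * u)) (k : ℕ) (hk : k < 2 ^ J) :
    AlmostPeriod f N (J * ε) (k * u) := by
  induction J generalizing k with
  | zero =>
    obtain rfl : k = 0 := by simpa using hk
    simpa using AlmostPeriod.zero f N
  | succ J ih =>
    have ih' := ih fun j hj => h j (hj.trans (Nat.lt_succ_self J))
    by_cases hkJ : k < 2 ^ J
    · exact (ih' k hkJ).mono hN (by push_cast; linarith)
    · obtain ⟨k', rfl⟩ := Nat.exists_eq_add_of_le (not_lt.1 hkJ)
      have h1 := (ih' k' (by rw [pow_succ] at hk; omega)).add (h J (Nat.lt_succ_self J))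
      convert h1 using 1
      · push_cast; ring
      · push_cast; ring

lemma exists_chain_of_cover {U X : Finset ℤ} (hU : U.Nonempty)
    (hcov : ∀ u ∈ U, ∃ x ∈ X, ∃ v ∈ U, 2 * u = x + v) (J : ℕ) :
    ∃ F ⊆ U, F.Nonempty ∧ #U ≤ #X ^ J * #F ∧
      ∀ q ∈ F, ∀ q' ∈ F, ∀ j ≤ J, ∃ v ∈ U, ∃ v' ∈ U, 2 ^ j * (q - q') = v - v' := by
  choose! ξ hξ η hη heq using hcov
  have hmap : ∀ j, ∀ u ∈ U, η^[j] u ∈ U := by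
    intro j
    induction j with
    | zero => exact fun u hu => hu
    | succ j ih =>
      intro u hu
      rw [Function.iterate_succ_apply']
      exact hη _ (ih u hu)
  suffices h : ∃ F ⊆ U, F.Nonempty ∧ #U ≤ #X ^ J * #F ∧
      ∀ q ∈ F, ∀ q' ∈ F, ∀ j ≤ J, 2 ^ j * (q - q') = η^[j] q - η^[j] q' by
    obtain ⟨F, hFU, hFne, hF, hd⟩ := h
    exact ⟨F, hFU, hFne, hF, fun q hq q' hq' j hj =>
      ⟨_, hmap j q (hFU hq), _, hmap j q' (hFU hq'), hd q hq q' hq' j hj⟩⟩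
  induction J with
  | zero =>
    refine ⟨U, Subset.rfl, hU, by simp, fun q _ q' _ j hj => ?_⟩
    obtain rfl : j = 0 := by omega
    simp
  | succ J ih =>
    obtain ⟨F, hFU, hFne, hF, hd⟩ := ih
    have hXne : X.Nonempty := let ⟨u, hu⟩ := hU; ⟨_, hξ u hu⟩
    obtain ⟨x, hx, hxF⟩ := exists_max_image X (fun x => #{q ∈ F | ξ (η^[J] q) = x}) hXne
    set F' := {q ∈ F | ξ (η^[J] q) = x} with hF'
    have hcard : #F ≤ #X * #F' := by
      rw [card_eq_sum_card_fiberwise (f := fun q => ξ (η^[J] q)) (t := X)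
        (fun q hq => hξ _ (hmap J q (hFU hq)))]
      exact sum_le_card_nsmul _ _ _ hxF
    have hF'ne : F'.Nonempty := by
      rw [← card_pos]
      by_contra hcon
      have : #F' = 0 := by omega
      rw [this, mul_zero] at hcard
      have := hFne.card_pos
      omega
    refine ⟨F', (filter_subset _ _).trans hFU, hF'ne, ?_, ?_⟩
    · calc #U ≤ #X ^ J * #F := hF
        _ ≤ #X ^ J * (#X * #F') := by gcongr
        _ = _ := by ring
    · intro q hq q' hq' j hj
      have hq1 := mem_filter.1 hq
      have hq2 := mem_filter.1 hq'
      rcases Nat.lt_or_ge j (J + 1) with hlt | hge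
      · exact hd q hq1.1 q' hq2.1 j (by omega)
      · obtain rfl : j = J + 1 := by omega
        have h0 := hd q hq1.1 q' hq2.1 J le_rfl
        have h1 := heq _ (hmap J q (hFU hq1.1))
        have h2 := heq _ (hmap J q' (hFU hq2.1))
        rw [hq1.2] at h1
        rw [hq2.2] at h2
        rw [Function.iterate_succ_apply', Function.iterate_succ_apply', pow_succ]
        linarith

/-- The proportion of `y ∈ B` with `x + y ∈ H`. -/
noncomputable def hitDensity (B H : Finset ℤ) (x : ℤ) : ℝ := #{y ∈ B | x + y ∈ H} / #B

/-- The proportion of indices `i` with `x + y i ∈ H`. -/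
noncomputable def sampleDensity {m : ℕ} (H : Finset ℤ) (y : Fin m → ℤ) (x : ℤ) : ℝ :=
  #{i | x + y i ∈ H} / m

lemma hitDensity_eq_zero {B H : Finset ℤ} {x : ℤ} (hx : x ∉ H - B) : hitDensity B H x = 0 := by
  have : {y ∈ B | x + y ∈ H} = ∅ := by
    rw [filter_eq_empty_iff]
    intro y hy h
    exact hx (by simpa using sub_mem_sub h hy)
  simp [hitDensity, this]

lemma sampleDensity_eq_zero {B H : Finset ℤ} {m : ℕ} {y : Fin m → ℤ}
    (hy : y ∈ Fintype.piFinset (fun _ : Fin m => B)) {x : ℤ} (hx : x ∉ H - B) :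
    sampleDensity H y x = 0 := by
  have : (univ.filter fun i => x + y i ∈ H) = ∅ := by
    rw [filter_eq_empty_iff]
    intro i _ h
    exact hx (by simpa using sub_mem_sub h (Fintype.mem_piFinset.1 hy i))
  simp [sampleDensity, this]

lemma card_sampleDensity_far_le {B : Finset ℤ} (hB : B.Nonempty) (H : Finset ℤ) {m : ℕ}
    (hm : 0 < m) {ε : ℝ} (hε0 : 0 ≤ ε) (hε1 : ε ≤ 1) (x : ℤ) :
    (#{y ∈ Fintype.piFinset (fun _ : Fin m => B) |
      ε < |sampleDensity H y x - hitDensity B H x|} : ℝ) ≤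
      2 * ((#B : ℝ) ^ m * Real.exp (-(ε ^ 2 * m / 4))) := by
  have hB0 : (0 : ℝ) < #B := by exact_mod_cast hB.card_pos
  have hm0 : (0 : ℝ) < m := by exact_mod_cast hm
  set μ := hitDensity B H x with hμ
  have hμ0 : 0 ≤ μ := by rw [hμ, hitDensity]; positivity
  have hμ1 : μ ≤ 1 := by
    rw [hμ, hitDensity]
    exact div_le_one_of_le₀ (by exact_mod_cast card_filter_le _ _) hB0.le
  set g : ℤ → ℝ := fun b => (if x + b ∈ H then 1 else 0) - μ with hg
  have hg1 : ∀ b ∈ B, |g b| ≤ 1 := by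
    intro b _
    rw [hg, abs_le]
    dsimp only
    split_ifs <;> constructor <;> linarith
  have hgs : ∑ b ∈ B, g b = 0 := by
    rw [hg, sum_sub_distrib, sum_const, nsmul_eq_mul]
    rw [← sum_filter, sum_const, nsmul_eq_mul, mul_one, hμ, hitDensity]
    field_simp
    simp
  refine le_trans ?_ (card_abs_sum_large_le hg1 hgs m hε0 hε1)
  refine Nat.cast_le.2 (card_le_card fun y hy => ?_)
  rw [mem_filter] at hy ⊢
  refine ⟨hy.1, ?_⟩
  have e : ∑ i, g (y i) = (sampleDensity H y x - μ) * m := by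
    rw [hg, sum_sub_distrib, sum_const, nsmul_eq_mul, sampleDensity, sub_mul, div_mul_cancel₀ _ hm0.ne',
      ← sum_filter, sum_const, nsmul_eq_mul, mul_one, card_univ, Fintype.card_fin, mul_comm (m : ℝ)]
  rw [e, abs_mul, abs_of_pos hm0]
  have := hy.2
  gcongr

/-- Most samples approximate the density at almost all points. -/
lemma card_good_samples {B : Finset ℤ} (hB : B.Nonempty) (H : Finset ℤ) {m : ℕ}
    (hm : 0 < m) {ε : ℝ} (hε0 : 0 < ε) (hε1 : ε ≤ 1)
    (hZ : 4 * #(H - B) * Real.exp (-(ε ^ 2 * m / 4)) ≤ ε * #B) :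
    (#B : ℝ) ^ m ≤ 2 * #{y ∈ Fintype.piFinset (fun _ : Fin m => B) |
      (#{x ∈ H - B | ε < |sampleDensity H y x - hitDensity B H x|} : ℝ) ≤ ε * #B} := by
  have hB0 : (0 : ℝ) < #B := by exact_mod_cast hB.card_pos
  set Y := Fintype.piFinset (fun _ : Fin m => B) with hY
  have hYc : (#Y : ℝ) = (#B : ℝ) ^ m := by rw [hY]; simp
  set bad : (Fin m → ℤ) → ℝ := fun y =>
    (#{x ∈ H - B | ε < |sampleDensity H y x - hitDensity B H x|} : ℝ) with hbad
  have hsum : ∑ y ∈ Y, bad y ≤ #(H - B) * (2 * ((#B : ℝ) ^ m * Real.exp (-(ε ^ 2 * m / 4)))) := by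
    have e : ∑ y ∈ Y, bad y =
        ∑ x ∈ H - B, (#{y ∈ Y | ε < |sampleDensity H y x - hitDensity B H x|} : ℝ) := by
      simp only [hbad, card_filter, Nat.cast_sum]
      exact sum_comm
    rw [e, ← nsmul_eq_mul]
    exact sum_le_card_nsmul _ _ _ fun x _ => card_sampleDensity_far_le hB H hm hε0.le hε1 x
  have hlow : (#(Y.filter fun y => ¬ bad y ≤ ε * #B) : ℝ) * (ε * #B) ≤ ∑ y ∈ Y, bad y := by
    rw [← nsmul_eq_mul, ← sum_const]
    refine (sum_le_sum fun y hy => (not_le.1 (mem_filter.1 hy).2).le).trans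
      (sum_le_sum_of_subset_of_nonneg (filter_subset _ _) fun _ _ _ => Nat.cast_nonneg _)
  have hadd : (#(Y.filter fun y => bad y ≤ ε * #B) : ℝ) + #(Y.filter fun y => ¬ bad y ≤ ε * #B) =
      (#B : ℝ) ^ m := by
    rw [← hYc, ← Nat.cast_add]
    exact_mod_cast card_filter_add_card_filter_not (s := Y) (fun y => bad y ≤ ε * #B)
  have h1 : (#(Y.filter fun y => ¬ bad y ≤ ε * #B) : ℝ) * (ε * #B) ≤
      ((#B : ℝ) ^ m / 2) * (ε * #B) := by
    refine (hlow.trans hsum).trans ?_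
    have := mul_le_mul_of_nonneg_left hZ (by positivity : 0 ≤ (#B : ℝ) ^ m / 2)
    linarith
  have h2 := le_of_mul_le_mul_right h1 (by positivity)
  change (#B : ℝ) ^ m ≤ 2 * (#(Y.filter fun y => bad y ≤ ε * #B) : ℝ)
  linarith

lemma sampleDensity_sub {m : ℕ} (H : Finset ℤ) (z : Fin m → ℤ) (t x : ℤ) :
    sampleDensity H (fun i => z i - t) (x + t) = sampleDensity H z x := by
  simp only [sampleDensity]
  congr 3
  ext i
  simp

/-- A sumset with small doubling has many almost periods of its density function, forming a
difference set. -/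
lemma exists_almostPeriods {B H : Finset ℤ} (hB : B.Nonempty) {m : ℕ}
    (hm : 0 < m) {ε L : ℝ} (hε0 : 0 < ε) (hε1 : ε ≤ 1)
    (hZ : 4 * #(H - B) * Real.exp (-(ε ^ 2 * m / 4)) ≤ ε * #B)
    (h2 : (#(B + B) : ℝ) ≤ L * #B) :
    ∃ T ⊆ B, T.Nonempty ∧ (#B : ℝ) ≤ 2 * L ^ m * #T ∧
      ∀ t ∈ T, ∀ t' ∈ T, AlmostPeriod (hitDensity B H) #B (2 * ε) (t - t') := by
  have hB0 : (0 : ℝ) < #B := by exact_mod_cast hB.card_pos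
  set Y := Fintype.piFinset (fun _ : Fin m => B) with hY
  set G := {y ∈ Y | (#{x ∈ H - B | ε < |sampleDensity H y x - hitDensity B H x|} : ℝ) ≤ ε * #B}
    with hG
  have hGc : (#B : ℝ) ^ m ≤ 2 * #G := card_good_samples hB H hm hε0 hε1 hZ
  set Q := Fintype.piFinset (fun _ : Fin m => B + B) with hQ
  have hQc : (#Q : ℝ) ≤ (L * #B) ^ m := by
    rw [hQ, Fintype.card_piFinset_const]
    push_cast
    gcongr
  have hGne : G.Nonempty := by
    rw [← card_pos]
    have : (0 : ℝ) < #G := by have : 0 < (#B : ℝ) ^ m := by positivity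
                              linarith
    exact_mod_cast this
  have hQne : Q.Nonempty := by
    obtain ⟨b, hb⟩ := hB
    exact ⟨fun _ => b + b, Fintype.mem_piFinset.2 fun _ => add_mem_add hb hb⟩
  set φ : (Fin m → ℤ) × ℤ → (Fin m → ℤ) := fun p i => p.1 i + p.2 with hφ
  obtain ⟨z, hz, hzmax⟩ := exists_max_image Q (fun z => #{p ∈ G ×ˢ B | φ p = z}) hQne
  have hpig : #(G ×ˢ B) ≤ #Q * #{p ∈ G ×ˢ B | φ p = z} := by
    rw [card_eq_sum_card_fiberwise (f := φ) (t := Q) (fun p hp => ?_)]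
    · exact sum_le_card_nsmul _ _ _ hzmax
    · have hp' := mem_product.1 (mem_coe.1 hp)
      refine mem_coe.2 (Fintype.mem_piFinset.2 fun i => add_mem_add ?_ hp'.2)
      exact Fintype.mem_piFinset.1 (mem_filter.1 hp'.1).1 i
  set T := {t ∈ B | (fun i => z i - t) ∈ G} with hT
  have hTc : #{p ∈ G ×ˢ B | φ p = z} ≤ #T := by
    refine card_le_card_of_injOn (fun p => p.2) ?_ ?_
    · rintro ⟨y, t⟩ hp
      simp only [coe_filter, mem_product, Set.mem_ofPred_eq] at hp
      obtain ⟨⟨hy, ht⟩, rfl⟩ := hp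
      refine mem_coe.2 (mem_filter.2 ⟨ht, ?_⟩)
      simpa [hφ] using hy
    · rintro ⟨y, t⟩ hp ⟨y', t'⟩ hp' htt
      simp only [coe_filter, mem_product, Set.mem_ofPred_eq] at hp hp' htt
      subst htt
      have : y = y' := by
        funext i
        have := congrFun (hp.2.trans hp'.2.symm) i
        simpa [hφ] using this
      rw [this]
  have hcount : (#G : ℝ) * #B ≤ (L * #B) ^ m * #T := by
    have h1 : (#G * #B : ℕ) ≤ #Q * #T := by
      rw [← card_product]; exact hpig.trans (Nat.mul_le_mul_left _ hTc)
    calc (#G : ℝ) * #B ≤ #Q * #T := by exact_mod_cast h1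
      _ ≤ _ := by gcongr
  have hfin : (#B : ℝ) ≤ 2 * L ^ m * #T := by
    have : (#B : ℝ) ^ m * #B ≤ (#B : ℝ) ^ m * (2 * L ^ m * #T) := by
      calc (#B : ℝ) ^ m * #B ≤ 2 * #G * #B := by gcongr
        _ ≤ 2 * ((L * #B) ^ m * #T) := by linarith
        _ = _ := by rw [mul_pow]; ring
    exact le_of_mul_le_mul_left this (by positivity)
  refine ⟨T, filter_subset _ _, ?_, hfin, ?_⟩
  · rw [← card_pos]
    rcases Nat.eq_zero_or_pos #T with h | h
    · rw [h, Nat.cast_zero, mul_zero] at hfin; linarith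
    · exact h
  have hgood : ∀ t ∈ T, ∃ E : Finset ℤ, (#E : ℝ) ≤ ε * #B ∧
      ∀ x ∉ E, |sampleDensity H z x - hitDensity B H (x + t)| ≤ ε := by
    intro t ht
    have hy := (mem_filter.1 ht).2
    have hyG := mem_filter.1 hy
    set y : Fin m → ℤ := fun i => z i - t with hydef
    refine ⟨({x ∈ H - B | ε < |sampleDensity H y x - hitDensity B H x|}).image (fun x => x - t),
      (Nat.cast_le.2 card_image_le).trans hyG.2, fun x hx => ?_⟩
    rw [← sampleDensity_sub H z t x]
    by_cases hxZ : x + t ∈ H - B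
    · by_contra hcon
      exact hx (mem_image.2 ⟨x + t, mem_filter.2 ⟨hxZ, not_le.1 hcon⟩, by ring⟩)
    · have e1 : sampleDensity H (fun i => z i - t) (x + t) = 0 :=
        sampleDensity_eq_zero hyG.1 hxZ
      rw [e1, hitDensity_eq_zero hxZ]
      simpa using hε0.le
  intro t ht t' ht'
  obtain ⟨E, hE, hEf⟩ := hgood t ht
  obtain ⟨E', hE', hEf'⟩ := hgood t' ht'
  refine ⟨(E ∪ E').image (fun x => x + t'), ?_, fun x hx => ?_⟩
  · have : (#((E ∪ E').image (fun x => x + t')) : ℝ) ≤ #E + #E' := by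
      exact_mod_cast card_image_le.trans (card_union_le _ _)
    linarith
  · have hx' : x - t' ∉ E ∪ E' := fun h => hx (mem_image.2 ⟨_, h, by ring⟩)
    rw [mem_union, not_or] at hx'
    have a1 := hEf _ hx'.1
    have a2 := hEf' _ hx'.2
    have e1 : x - t' + t = x + (t - t') := by ring
    have e2 : x - t' + t' = x := by ring
    rw [e1] at a1
    rw [e2] at a2
    rw [abs_le] at a1 a2 ⊢
    constructor <;> linarith [a1.1, a1.2, a2.1, a2.2]

/-- A set of small doubling has a large set `F` whose dilates by all factors below `2 ^ J`
interact additively with any subset `A₁` of `B`. -/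
lemma exists_dilate_popular {B : Finset ℤ} (hB : B.Nonempty) {L : ℝ} (hL : 2 ≤ L) {J m : ℕ}
    (hJ : 0 < J) (hm : 0 < m) (h2 : (#(B + B) : ℝ) ≤ L ^ 2 * #B)
    (h4 : (#(B + B + B - B) : ℝ) ≤ L ^ 4 * #B)
    (h5 : (#(B + B + B - B - B) : ℝ) ≤ L ^ 5 * #B)
    (hexp : 64 * J * L ^ 4 ≤ Real.exp (m / (1024 * (J : ℝ) ^ 2))) :
    ∃ F : Finset ℤ, F.Nonempty ∧ (#B : ℝ) ≤ L ^ (11 * m * J) * #F ∧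
      ∀ k : ℕ, k < 2 ^ J → ∀ A₁ ⊆ B, ∃ V : Finset ℤ, (#V : ℝ) ≤ L ^ 4 * #B ∧
        #A₁ * #F ≤ 2 * #{p ∈ A₁ ×ˢ F | p.1 + (k : ℤ) * p.2 ∈ V} := by
  have hB0 : (0 : ℝ) < #B := by exact_mod_cast hB.card_pos
  have hJ0 : (1 : ℝ) ≤ J := by exact_mod_cast hJ
  have hL0 : 0 < L := by linarith
  set H := B + B + B with hH
  set ε : ℝ := 1 / (16 * J) with hε
  have hε0 : 0 < ε := by positivity
  have hε1 : ε ≤ 1 := by rw [hε, div_le_one (by positivity)]; linarith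
  have hZ : 4 * #(H - B) * Real.exp (-(ε ^ 2 * m / 4)) ≤ ε * #B := by
    have e : ε ^ 2 * m / 4 = m / (1024 * (J : ℝ) ^ 2) := by rw [hε]; field_simp; norm_num
    rw [e, Real.exp_neg, ← div_eq_mul_inv, div_le_iff₀ (Real.exp_pos _)]
    calc 4 * (#(H - B) : ℝ) ≤ 4 * (L ^ 4 * #B) := by gcongr
      _ = ε * #B * (64 * J * L ^ 4) := by rw [hε]; field_simp; norm_num
      _ ≤ _ := by gcongr
  obtain ⟨T, hTB, hTne, hTc, hper⟩ := exists_almostPeriods hB hm hε0 hε1 hZ h2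
  have hT0 : (0 : ℝ) < #T := by exact_mod_cast hTne.card_pos
  set U := T - T with hU
  have hUne : U.Nonempty := hTne.sub hTne
  set W := U.image (fun u => 2 * u) with hW
  have hWT : (#(W + T) : ℝ) ≤ (2 * L ^ (5 + 2 * m)) * #T := by
    have hsub : W + T ⊆ B + B + B - B - B := by
      intro w hw
      obtain ⟨w', hw', t, ht, rfl⟩ := mem_add.1 hw
      obtain ⟨u, hu, rfl⟩ := mem_image.1 hw'
      obtain ⟨t1, ht1, t2, ht2, rfl⟩ := mem_sub.1 hu
      have e : 2 * (t1 - t2) + t = t1 + t1 + t - t2 - t2 := by ring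
      rw [e]
      exact sub_mem_sub (sub_mem_sub (add_mem_add (add_mem_add (hTB ht1) (hTB ht1)) (hTB ht))
        (hTB ht2)) (hTB ht2)
    calc (#(W + T) : ℝ) ≤ #(B + B + B - B - B) := Nat.cast_le.2 (card_le_card hsub)
      _ ≤ L ^ 5 * #B := h5
      _ ≤ L ^ 5 * (2 * (L ^ 2) ^ m * #T) := by gcongr
      _ = _ := by ring
  obtain ⟨X, hXW, hXc, hcov⟩ := ruzsa_covering_add (A := W) hTne hWT
  obtain ⟨F, hFU, hFne, hFc, hF⟩ := exists_chain_of_cover (U := U) (X := X) hUne (fun u hu => by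
    obtain ⟨x, hx, v, hv, h⟩ := mem_add.1 (hcov (mem_image_of_mem _ hu))
    exact ⟨x, hx, v, hv, h.symm⟩) J
  refine ⟨F, hFne, ?_, fun k hk A₁ hA₁ => ?_⟩
  · have hTU : (#T : ℝ) ≤ #U := by
      obtain ⟨t, ht⟩ := hTne
      refine Nat.cast_le.2 (card_le_card_of_injOn (fun x => x - t)
        (fun x hx => sub_mem_sub hx ht) fun x _ y _ h => by simpa using h)
    have hUF : (#U : ℝ) ≤ (#X : ℝ) ^ J * #F := by exact_mod_cast hFc
    have hL1 : 1 ≤ L := by linarith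
    calc (#B : ℝ) ≤ 2 * (L ^ 2) ^ m * #T := hTc
      _ ≤ 2 * (L ^ 2) ^ m * ((2 * L ^ (5 + 2 * m)) ^ J * #F) := by
          gcongr
          exact hTU.trans (hUF.trans (by gcongr))
      _ ≤ L * (L ^ 2) ^ m * ((L * L ^ (5 + 2 * m)) ^ J * #F) := by gcongr
      _ = L ^ (1 + 2 * m + (6 + 2 * m) * J) * #F := by
          ring
      _ ≤ _ := by
          gcongr
          nlinarith [Nat.mul_le_mul hm hJ, Nat.mul_le_mul_left m hJ, Nat.mul_le_mul_right J hm]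
  · obtain ⟨q₀, hq₀⟩ := id hFne
    set f := hitDensity B H with hf
    have hAP : ∀ q ∈ F, AlmostPeriod f #B (1 / 4) (k * (q - q₀)) := by
      intro q hq
      have h := AlmostPeriod.mul_of_two_pow (f := f) (N := #B) (ε := 2 * ε + 2 * ε) hB0.le
        (by positivity) (u := q - q₀) J (fun j hj => ?_) k hk
      · convert h using 1
        rw [hε]; field_simp; norm_num
      · obtain ⟨v, hv, v', hv', e⟩ := hF q hq q₀ hq₀ j hj.le
        obtain ⟨t1, ht1, t2, ht2, rfl⟩ := mem_sub.1 hv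
        obtain ⟨t3, ht3, t4, ht4, rfl⟩ := mem_sub.1 hv'
        have e' : (2 : ℤ) ^ j * (q - q₀) = (t1 - t2) + (t4 - t3) := by rw [e]; ring
        rw [e']
        exact (hper t1 ht1 t2 ht2).add (hper t4 ht4 t3 ht3)
    have hrow : ∀ p ∈ A₁ ×ˢ F, (#B : ℝ) / 2 ≤
        #{y ∈ B | p.1 + y + k * (p.2 - q₀) ∈ H - B} := by
      rintro ⟨a, q⟩ hp
      obtain ⟨ha, hq⟩ := mem_product.1 hp
      obtain ⟨E, hE, hEf⟩ := hAP q hq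
      have hsub : B \ E.image (fun x => x - a) ⊆ {y ∈ B | a + y + k * (q - q₀) ∈ H - B} := by
        intro y hy
        rw [mem_sdiff] at hy
        refine mem_filter.2 ⟨hy.1, ?_⟩
        by_contra hcon
        have hyE : a + y ∉ E := fun h => hy.2 (mem_image.2 ⟨a + y, h, by ring⟩)
        have h1 := hEf _ hyE
        have e0 : f (a + y + k * (q - q₀)) = 0 := hitDensity_eq_zero hcon
        have e1 : f (a + y) = 1 := by
          rw [hf, hitDensity, filter_true_of_mem, div_self hB0.ne']
          intro z hz
          exact add_mem_add (add_mem_add (hA₁ ha) hy.1) hz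
        rw [e0, e1] at h1
        norm_num at h1
      have h1 : (#B : ℝ) ≤ #(B \ E.image (fun x => x - a)) + #E := by
        have := le_card_sdiff (E.image (fun x => x - a)) B
        have h3 : #(E.image (fun x => x - a)) ≤ #E := card_image_le
        have : #B ≤ #(B \ E.image (fun x => x - a)) + #E := by omega
        exact_mod_cast this
      have h2 : (#(B \ E.image (fun x => x - a)) : ℝ) ≤
          #{y ∈ B | a + y + k * (q - q₀) ∈ H - B} := Nat.cast_le.2 (card_le_card hsub)
      linarith
    have htot : ∑ _y ∈ B, (#A₁ * #F : ℝ) / 2 ≤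
        ∑ y ∈ B, (#{p ∈ A₁ ×ˢ F | p.1 + y + k * (p.2 - q₀) ∈ H - B} : ℝ) := by
      have e : ∑ y ∈ B, (#{p ∈ A₁ ×ˢ F | p.1 + y + k * (p.2 - q₀) ∈ H - B} : ℝ) =
          ∑ p ∈ A₁ ×ˢ F, (#{y ∈ B | p.1 + y + k * (p.2 - q₀) ∈ H - B} : ℝ) := by
        simp only [card_filter, Nat.cast_sum]
        exact sum_comm
      rw [e]
      refine le_trans (le_of_eq ?_) (card_nsmul_le_sum _ _ _ hrow)
      rw [sum_const, nsmul_eq_mul, nsmul_eq_mul, card_product]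
      push_cast; ring
    obtain ⟨y, -, hy⟩ := exists_le_of_sum_le hB htot
    refine ⟨(H - B).image (fun z => z - y + k * q₀), (Nat.cast_le.2 card_image_le).trans h4, ?_⟩
    have hsub : {p ∈ A₁ ×ˢ F | p.1 + y + k * (p.2 - q₀) ∈ H - B} ⊆
        {p ∈ A₁ ×ˢ F | p.1 + (k : ℤ) * p.2 ∈ (H - B).image (fun z => z - y + k * q₀)} := by
      intro p hp
      rw [mem_filter] at hp ⊢
      exact ⟨hp.1, mem_image.2 ⟨_, hp.2, by ring⟩⟩
    have h1 : (#A₁ * #F : ℝ) ≤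
        2 * #{p ∈ A₁ ×ˢ F | p.1 + (k : ℤ) * p.2 ∈ (H - B).image (fun z => z - y + k * q₀)} := by
      have := (Nat.cast_le (α := ℝ)).2 (card_le_card hsub)
      linarith
    exact_mod_cast h1

/-- An edge-isoperimetric inequality for the graph joining `v` to `p v` for primes `p`. -/
lemma card_mul_edges_le (P : Finset ℕ) (hP : ∀ p ∈ P, p.Prime) (V : Finset ℚ) (hV : (0 : ℚ) ∉ V)
    (l : ℕ) (hl : #V ≤ 2 ^ l) :
    #{e ∈ V ×ˢ P | (e.2 : ℚ) * e.1 ∈ V} ≤ l * #V := by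
  induction V using Finset.strongInduction generalizing l with
  | H V ih =>
  rcases eq_empty_or_nonempty {e ∈ V ×ˢ P | (e.2 : ℚ) * e.1 ∈ V} with hem | ⟨⟨v, p⟩, hvp⟩
  · rw [hem]; simp
  simp only [mem_filter, mem_product] at hvp
  obtain ⟨⟨hv, hp⟩, hpv⟩ := hvp
  have : Fact p.Prime := ⟨hP p hp⟩
  have hp0 : (p : ℚ) ≠ 0 := by exact_mod_cast (hP p hp).ne_zero
  have hne : ∀ {w}, w ∈ V → w ≠ 0 := fun hw h => hV (h ▸ hw)
  have hval : ∀ w ∈ V, ∀ q ∈ P, padicValRat p ((q : ℚ) * w) =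
      (if q = p then 1 else 0) + padicValRat p w := by
    intro w hw q hq
    rw [padicValRat.mul (by exact_mod_cast (hP q hq).ne_zero) (hne hw)]
    congr 1
    split_ifs with h
    · subst h; exact padicValRat.self (hP q hq).one_lt
    · rw [padicValRat.of_nat, padicValNat_primes (hp := this) (hq := ⟨hP q hq⟩) (Ne.symm h)]
      rfl
  set t := padicValRat p v with ht
  set V₀ := {w ∈ V | padicValRat p w ≤ t} with hV₀
  set V₁ := {w ∈ V | ¬ padicValRat p w ≤ t} with hV₁
  have hadd : #V₀ + #V₁ = #V := card_filter_add_card_filter_not _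
  have hpos₀ : 0 < #V₀ := card_pos.2 ⟨v, mem_filter.2 ⟨hv, le_rfl⟩⟩
  have hpos₁ : 0 < #V₁ := card_pos.2 ⟨p * v, mem_filter.2 ⟨hpv, by
    rw [hval v hv p hp, if_pos rfl]; omega⟩⟩
  have hs₀ : V₀ ⊂ V := (filter_subset _ _).ssubset_of_ne fun h => by
    rw [hV₀, h] at hadd; omega
  have hs₁ : V₁ ⊂ V := (filter_subset _ _).ssubset_of_ne fun h => by
    rw [hV₁, h] at hadd; omega
  have ih₀ := ih V₀ hs₀ (fun h => hV (hs₀.1 h))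
  have ih₁ := ih V₁ hs₁ (fun h => hV (hs₁.1 h))
  set E := {e ∈ V ×ˢ P | (e.2 : ℚ) * e.1 ∈ V} with hE
  set E₀ := {e ∈ V₀ ×ˢ P | (e.2 : ℚ) * e.1 ∈ V₀} with hE₀
  set E₁ := {e ∈ V₁ ×ˢ P | (e.2 : ℚ) * e.1 ∈ V₁} with hE₁
  set X := {w ∈ V₀ | (p : ℚ) * w ∈ V₁} with hX
  have hsub : E ⊆ (E₀ ∪ E₁) ∪ X.image (fun w => (w, p)) := by
    rintro ⟨w, q⟩ he
    simp only [hE, mem_filter, mem_product] at he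
    obtain ⟨⟨hw, hq⟩, hqw⟩ := he
    have hvq := hval w hw q hq
    simp only [mem_union, hE₀, hE₁, hX, hV₀, hV₁, mem_filter, mem_product, mem_image,
      Prod.mk.injEq]
    by_cases h1 : padicValRat p w ≤ t
    · by_cases h2 : padicValRat p ((q : ℚ) * w) ≤ t
      · exact Or.inl (Or.inl ⟨⟨⟨hw, h1⟩, hq⟩, hqw, h2⟩)
      · have hqp : q = p := by
          by_contra hcon
          rw [hvq, if_neg hcon, zero_add] at h2
          exact h2 h1
        subst hqp
        exact Or.inr ⟨w, ⟨⟨hw, h1⟩, hqw, h2⟩, rfl, rfl⟩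
    · refine Or.inl (Or.inr ⟨⟨⟨hw, h1⟩, hq⟩, hqw, ?_⟩)
      rw [hvq]
      split_ifs <;> omega
  have hXc₀ : #X ≤ #V₀ := card_filter_le _ _
  have hXc₁ : #X ≤ #V₁ := card_le_card_of_injOn (fun w => (p : ℚ) * w)
    (fun w hw => (mem_filter.1 hw).2) fun a _ b _ h => mul_left_cancel₀ hp0 h
  have hEc : #E ≤ #E₀ + #E₁ + #X :=
    (card_le_card hsub).trans ((card_union_le _ _).trans
      (add_le_add (card_union_le _ _) card_image_le))
  obtain ⟨k, rfl⟩ : ∃ k, l = k + 1 := Nat.exists_eq_succ_of_ne_zero (by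
    rintro rfl
    rw [pow_zero] at hl
    omega)
  rw [pow_succ] at hl
  have hmain : ∀ a b : ℕ, a + b = #V → #E ≤ k * a + (k + 1) * b + a → #E ≤ (k + 1) * #V := by
    intro a b hab h
    rw [← hab]; linarith
  rcases le_total #V₀ #V₁ with h | h
  · refine hmain #V₀ #V₁ hadd ?_
    have := ih₀ k (by omega)
    have := ih₁ (k + 1) (by rw [pow_succ]; omega)
    omega
  · refine hmain #V₁ #V₀ (by omega) ?_
    have := ih₁ k (by omega)
    have := ih₀ (k + 1) (by rw [pow_succ]; omega)
    omega

/-- The number of `p ∈ P` for which `p x ∈ M`. -/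
def mulMult (P : Finset ℕ) (M : Finset ℚ) (x : ℚ) : ℕ := #(P.filter fun p : ℕ => (p : ℚ) * x ∈ M)

lemma card_heavy_le {P : Finset ℕ} (hP : ∀ p ∈ P, p.Prime) {M : Finset ℚ} (hM : (0 : ℚ) ∉ M)
    {Δ R l : ℕ} (hPR : #P ≤ Δ * R) (hl : #M * (1 + R) ≤ 2 ^ l) :
    #{e ∈ M ×ˢ P | Δ < mulMult P M (e.1 / e.2)} ≤ l * (#M * (1 + R)) := by
  set W := {e ∈ M ×ˢ P | Δ < mulMult P M (e.1 / e.2)} with hW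
  set X := W.image (fun e => e.1 / (e.2 : ℚ)) with hX
  have hp0 : ∀ p ∈ P, (p : ℚ) ≠ 0 := fun p hp => by exact_mod_cast (hP p hp).ne_zero
  have hXc : #X * (Δ + 1) ≤ #M * #P := by
    have h1 : ∑ x ∈ X, mulMult P M x ≤ #(M ×ˢ P) := by
      have e : ∑ x ∈ X, mulMult P M x = #(X.sigma fun x => P.filter fun p : ℕ => (p : ℚ) * x ∈ M) := by
        rw [card_sigma]; rfl
      rw [e]
      refine card_le_card_of_injOn (fun s => ((s.2 : ℚ) * s.1, s.2)) ?_ ?_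
      · rintro ⟨x, p⟩ h
        simp only [coe_sigma, Set.mem_sigma_iff, mem_coe, mem_filter] at h
        exact mem_coe.2 (mem_product.2 ⟨h.2.2, h.2.1⟩)
      · rintro ⟨x, p⟩ h ⟨y, q⟩ _ heq
        simp only [coe_sigma, Set.mem_sigma_iff, mem_coe, mem_filter] at h
        simp only [Prod.mk.injEq] at heq
        obtain ⟨h1, rfl⟩ := heq
        rw [mul_left_cancel₀ (hp0 p h.2.1) h1]
    rw [card_product] at h1
    refine le_trans ?_ h1
    rw [← smul_eq_mul]
    refine card_nsmul_le_sum _ _ _ fun x hx => ?_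
    obtain ⟨e, he, rfl⟩ := mem_image.1 hx
    exact (mem_filter.1 he).2
  have hXR : #X ≤ #M * R := by
    have : #X * (Δ + 1) ≤ (#M * R) * (Δ + 1) := by
      calc _ ≤ #M * #P := hXc
        _ ≤ #M * (Δ * R) := by gcongr
        _ ≤ _ := by nlinarith [Nat.zero_le (#M * R)]
    exact Nat.le_of_mul_le_mul_right this (Nat.succ_pos _)
  have hX0 : (0 : ℚ) ∉ X := by
    intro h
    obtain ⟨e, he, h0⟩ := mem_image.1 h
    have he' := mem_product.1 (mem_filter.1 he).1
    rcases div_eq_zero_iff.1 h0 with h | h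
    · exact hM (h ▸ he'.1)
    · exact hp0 _ he'.2 h
  have hVc : #(M ∪ X) ≤ #M * (1 + R) := by
    have := card_union_le M X
    rw [mul_add, mul_one]; omega
  have hedges := card_mul_edges_le P hP (M ∪ X) (by simp [hM, hX0]) l (hVc.trans hl)
  refine le_trans ?_ (hedges.trans (Nat.mul_le_mul_left _ hVc))
  refine card_le_card_of_injOn (fun e => (e.1 / (e.2 : ℚ), e.2)) ?_ ?_
  · rintro ⟨m, p⟩ h
    have hmp := mem_product.1 (mem_filter.1 h).1
    refine mem_coe.2 (mem_filter.2 ⟨mem_product.2 ⟨mem_union_right _ (mem_image_of_mem _ h),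
      hmp.2⟩, mem_union_left _ ?_⟩)
    simp only
    rw [mul_div_cancel₀ _ (hp0 p hmp.2)]
    exact hmp.1
  · rintro ⟨m, p⟩ h ⟨m', p'⟩ _ heq
    have hmp := mem_product.1 (mem_filter.1 h).1
    simp only [Prod.mk.injEq] at heq
    obtain ⟨h1, rfl⟩ := heq
    rw [div_left_inj' (hp0 p hmp.2)] at h1
    rw [h1]

/-- For at least half of the primes in `P`, at least half of the quotients `m / p` have small
multiplicity. -/
lemma card_good_primes {P : Finset ℕ} (hP : ∀ p ∈ P, p.Prime) {M : Finset ℚ} (hM : (0 : ℚ) ∉ M)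
    (hMne : M.Nonempty) {Δ R l : ℕ} (hPR : #P ≤ Δ * R) (hl : #M * (1 + R) ≤ 2 ^ l)
    (hlP : 4 * (l * (1 + R)) ≤ #P) :
    #P ≤ 2 * #(P.filter fun p : ℕ => #M ≤ 2 * #{m ∈ M | mulMult P M (m / p) ≤ Δ}) := by
  have hW := card_heavy_le hP hM hPR hl
  set W := {e ∈ M ×ˢ P | Δ < mulMult P M (e.1 / e.2)} with hWdef
  set Q := P.filter fun p : ℕ => ¬ #M ≤ 2 * #{m ∈ M | mulMult P M (m / p) ≤ Δ} with hQ
  have hadd : #(P.filter fun p : ℕ => #M ≤ 2 * #{m ∈ M | mulMult P M (m / p) ≤ Δ}) + #Q = #P :=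
    card_filter_add_card_filter_not _
  have hlow : #Q * #M ≤ 2 * #W := by
    have e : #W = ∑ p ∈ P, #{m ∈ M | Δ < mulMult P M (m / p)} := by
      rw [hWdef, card_filter, sum_product_right]
      simp only [card_filter]
    rw [e, mul_sum, ← smul_eq_mul]
    refine le_trans (card_nsmul_le_sum Q (fun p => 2 * #{m ∈ M | Δ < mulMult P M (m / p)}) #M
      fun p hp => ?_) (sum_le_sum_of_subset (filter_subset _ _))
    have h1 := (mem_filter.1 hp).2
    have h2 : #{m ∈ M | mulMult P M (m / p) ≤ Δ} + #{m ∈ M | ¬ mulMult P M (m / p) ≤ Δ} = #M :=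
      card_filter_add_card_filter_not _
    simp only [not_le] at h1 h2
    omega
  have hfin : (2 * #Q) * #M ≤ #P * #M := by
    calc (2 * #Q) * #M ≤ 2 * (2 * #W) := by linarith
      _ ≤ 2 * (2 * (l * (#M * (1 + R)))) := by gcongr
      _ = (4 * (l * (1 + R))) * #M := by ring
      _ ≤ _ := by gcongr
  have := Nat.le_of_mul_le_mul_right hfin hMne.card_pos
  omega

/-- The triples of distinct elements of a finite set number at least `c³/8 - 8`. -/
lemma card_distinct_triples (Q : Finset ℤ) :
    (#Q : ℝ) ^ 3 / 8 - 8 ≤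
      #{t ∈ Q ×ˢ Q ×ˢ Q | t.1 ≠ t.2.1 ∧ t.1 ≠ t.2.2 ∧ t.2.1 ≠ t.2.2} := by
  set G := {t ∈ Q ×ˢ Q ×ˢ Q | t.1 ≠ t.2.1 ∧ t.1 ≠ t.2.2 ∧ t.2.1 ≠ t.2.2} with hG
  have hsub : Q ×ˢ Q ×ˢ Q ⊆ G ∪ ((Q ×ˢ Q).image (fun t => (t.1, t.1, t.2)) ∪
      ((Q ×ˢ Q).image (fun t => (t.1, t.2, t.1)) ∪ (Q ×ˢ Q).image (fun t => (t.1, t.2, t.2)))) := by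
    rintro ⟨x, y, z⟩ h
    simp only [mem_product] at h
    simp only [hG, mem_union, mem_filter, mem_product, mem_image, Prod.mk.injEq, Prod.exists]
    by_cases h1 : x = y
    · exact Or.inr (Or.inl ⟨x, z, ⟨h.1, h.2.2⟩, rfl, h1, rfl⟩)
    by_cases h2 : x = z
    · exact Or.inr (Or.inr (Or.inl ⟨x, y, ⟨h.1, h.2.1⟩, rfl, rfl, h2⟩))
    by_cases h3 : y = z
    · exact Or.inr (Or.inr (Or.inr ⟨x, y, ⟨h.1, h.2.1⟩, rfl, rfl, h3⟩))
    exact Or.inl ⟨h, h1, h2, h3⟩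
  have hQ : #(Q ×ˢ Q) = #Q * #Q := card_product _ _
  have hcard : #Q * (#Q * #Q) ≤ #G + (#Q * #Q + (#Q * #Q + #Q * #Q)) := by
    have h := card_le_card hsub
    rw [card_product, card_product] at h
    refine h.trans ((card_union_le _ _).trans (Nat.add_le_add_left ((card_union_le _ _).trans
      (add_le_add (hQ ▸ card_image_le) ((card_union_le _ _).trans
        (add_le_add (hQ ▸ card_image_le) (hQ ▸ card_image_le))))) _))
  have hcard' : (#Q : ℝ) * (#Q * #Q) ≤ #G + (#Q * #Q + (#Q * #Q + #Q * #Q)) := by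
    exact_mod_cast hcard
  have hQ0 : (0 : ℝ) ≤ #Q := Nat.cast_nonneg _
  nlinarith [mul_nonneg hQ0 (sq_nonneg ((#Q : ℝ) - 16 / 7)), sq_nonneg ((#Q : ℝ) - 16 / 7)]

/-- Many incidences force many triples of distinct `q ∈ F` lying on a common line. -/
lemma card_incidences_pow_three_le (A₁ F V : Finset ℤ) (k : ℤ)
    (h : 6 * #V ≤ #{p ∈ A₁ ×ˢ F | p.1 + k * p.2 ∈ V}) :
    (#{p ∈ A₁ ×ˢ F | p.1 + k * p.2 ∈ V} : ℝ) ^ 3 ≤ 16 * (#V : ℝ) ^ 2 *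
      #{t ∈ A₁ ×ˢ F ×ˢ F ×ˢ F |
        (t.2.1 ≠ t.2.2.1 ∧ t.2.1 ≠ t.2.2.2 ∧ t.2.2.1 ≠ t.2.2.2) ∧
        t.1 + k * (t.2.1 - t.2.2.1) ∈ A₁ ∧ t.1 + k * (t.2.1 - t.2.2.2) ∈ A₁} := by
  set S := #{p ∈ A₁ ×ˢ F | p.1 + k * p.2 ∈ V} with hS
  set T := {t ∈ A₁ ×ˢ F ×ˢ F ×ˢ F |
        (t.2.1 ≠ t.2.2.1 ∧ t.2.1 ≠ t.2.2.2 ∧ t.2.2.1 ≠ t.2.2.2) ∧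
        t.1 + k * (t.2.1 - t.2.2.1) ∈ A₁ ∧ t.1 + k * (t.2.1 - t.2.2.2) ∈ A₁} with hT
  set Q : ℤ → Finset ℤ := fun v => {q ∈ F | v - k * q ∈ A₁} with hQ
  have hSsum : S = ∑ v ∈ V, #(Q v) := by
    rw [← card_sigma]
    refine card_nbij' (fun p => ⟨p.1 + k * p.2, p.2⟩) (fun s => (s.1 - k * s.2, s.2)) ?_ ?_ ?_ ?_
    · rintro ⟨a, q⟩ hp
      simp only [coe_filter, mem_product, Set.mem_ofPred_eq] at hp
      simp only [coe_sigma, Set.mem_sigma_iff, mem_coe, hQ, mem_filter, add_sub_cancel_right]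
      exact ⟨hp.2, hp.1.2, hp.1.1⟩
    · rintro ⟨v, q⟩ hp
      simp only [coe_sigma, Set.mem_sigma_iff, mem_coe, hQ, mem_filter] at hp
      simp only [coe_filter, mem_product, Set.mem_ofPred_eq, sub_add_cancel]
      exact ⟨⟨hp.2.2, hp.2.1⟩, hp.1⟩
    · rintro ⟨a, q⟩ _; simp
    · rintro ⟨v, q⟩ _; simp
  have hTsum : ∑ v ∈ V, #{t ∈ Q v ×ˢ Q v ×ˢ Q v | t.1 ≠ t.2.1 ∧ t.1 ≠ t.2.2 ∧ t.2.1 ≠ t.2.2} ≤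
      #T := by
    rw [← card_sigma]
    refine card_le_card_of_injOn (fun s => (s.1 - k * s.2.1, s.2)) ?_ ?_
    · rintro ⟨v, x, y, z⟩ hp
      simp only [coe_sigma, Set.mem_sigma_iff, mem_coe, hQ, mem_filter, mem_product] at hp
      obtain ⟨-, ⟨⟨hx, hx'⟩, ⟨hy, hy'⟩, hz, hz'⟩, hd⟩ := hp
      simp only [hT, coe_filter, mem_product, Set.mem_ofPred_eq]
      refine ⟨⟨hx', hx, hy, hz⟩, hd, ?_, ?_⟩
      · convert hy' using 1; ring
      · convert hz' using 1; ring
    · rintro ⟨v, x, y, z⟩ _ ⟨v', x', y', z'⟩ _ heq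
      simp only [Prod.mk.injEq] at heq
      obtain ⟨h1, rfl, rfl, rfl⟩ := heq
      obtain rfl : v = v' := by linarith
      rfl
  have hpow : (S : ℝ) ^ 3 ≤ (#V : ℝ) ^ 2 * ∑ v ∈ V, (#(Q v) : ℝ) ^ 3 := by
    have h := pow_sum_div_card_le_sum_pow (s := V) (f := fun v => (#(Q v) : ℝ))
      (fun _ _ => Nat.cast_nonneg _) 2
    rcases V.eq_empty_or_nonempty with rfl | hV
    · simp [hSsum]
    rw [div_le_iff₀ (by have := hV.card_pos; positivity)] at h
    rw [hSsum, mul_comm]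
    push_cast
    exact h
  have hlow : ∑ v ∈ V, ((#(Q v) : ℝ) ^ 3 / 8 - 8) ≤ (#T : ℝ) := by
    refine (sum_le_sum fun v _ => card_distinct_triples (Q v)).trans ?_
    exact_mod_cast hTsum
  rw [sum_sub_distrib, sum_const, nsmul_eq_mul, ← sum_div] at hlow
  have hV0 : (0 : ℝ) ≤ #V := Nat.cast_nonneg _
  have h' : 6 * (#V : ℝ) ≤ S := by exact_mod_cast h
  have h3 : (6 * (#V : ℝ)) ^ 3 ≤ (S : ℝ) ^ 3 := by gcongr
  have h4 := mul_le_mul_of_nonneg_left hlow (sq_nonneg (#V : ℝ))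
  nlinarith

/-- For a family of dilates by primes, quadruples consisting of a cube root `m` and three points
`q` for which `m³ + p³(q₁ - q₂)` and `m³ + p³(q₁ - q₃)` are cubes are rare, as they give rational
points `m / p` on a curve determined by the `q`s. -/
lemma sum_card_quadruples_le {C : ℕ} (hU : UCube C) (P P' : Finset ℕ) (hsub : P' ⊆ P)
    (hP0 : ∀ p ∈ P, p ≠ 0) (M₀ F : Finset ℤ) (Δ : ℕ)
    (T : ℕ → Finset (ℤ × ℤ × ℤ × ℤ))
    (hT : ∀ p ∈ P', ∀ t ∈ T p, (t.1 ∈ M₀ ∧ t.2 ∈ F ×ˢ F ×ˢ F) ∧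
      mulMult P (M₀.image (Int.cast : ℤ → ℚ)) ((t.1 : ℚ) / p) ≤ Δ ∧
      (t.2.1 ≠ t.2.2.1 ∧ t.2.1 ≠ t.2.2.2 ∧ t.2.2.1 ≠ t.2.2.2) ∧
      (∃ u : ℤ, t.1 ^ 3 + (p : ℤ) ^ 3 * (t.2.1 - t.2.2.1) = u ^ 3) ∧
      ∃ v : ℤ, t.1 ^ 3 + (p : ℤ) ^ 3 * (t.2.1 - t.2.2.2) = v ^ 3) :
    ∑ p ∈ P', #(T p) ≤ C * Δ * #F ^ 3 := by
  rw [← card_sigma]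
  set W := P'.sigma T with hW
  have hmaps : ∀ w ∈ W, w.2.2 ∈ F ×ˢ F ×ˢ F := by
    rintro ⟨p, t⟩ hw
    rw [hW, mem_sigma] at hw
    exact (hT p hw.1 t hw.2).1.2
  have hfib : ∀ f ∈ F ×ˢ F ×ˢ F, #{w ∈ W | w.2.2 = f} ≤ C * Δ := by
    rintro ⟨q₁, q₂, q₃⟩ -
    set Y := {w ∈ W | w.2.2 = (q₁, q₂, q₃)} with hY
    rcases Y.eq_empty_or_nonempty with hem | ⟨⟨p₀, m₀, f₀⟩, hw₀⟩
    · rw [hem]; simp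
    have hmem : ∀ {p m f}, (⟨p, m, f⟩ : Σ _ : ℕ, ℤ × ℤ × ℤ × ℤ) ∈ Y → p ∈ P' ∧ (m, f) ∈ T p ∧
        f = (q₁, q₂, q₃) := by
      intro p m f h
      simp only [hY, hW, mem_filter, mem_sigma] at h
      exact ⟨h.1.1, h.1.2, h.2⟩
    have hdist : q₁ ≠ q₂ ∧ q₁ ≠ q₃ ∧ q₂ ≠ q₃ := by
      obtain ⟨h1, h2, rfl⟩ := hmem hw₀
      exact (hT p₀ h1 _ h2).2.2.1
    set g : (Σ _ : ℕ, ℤ × ℤ × ℤ × ℤ) → ℚ := fun w => (w.2.1 : ℚ) / w.1 with hg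
    have himg : #(Y.image g) ≤ C := by
      refine hU.card_le (a := q₁ - q₂) (b := q₁ - q₃) (sub_ne_zero.2 hdist.1)
        (sub_ne_zero.2 hdist.2.1) (fun h => hdist.2.2 (by linarith)) _ ?_
      intro x hx
      obtain ⟨⟨p, m, f⟩, hw, rfl⟩ := mem_image.1 hx
      obtain ⟨h1, h2, rfl⟩ := hmem hw
      obtain ⟨-, -, -, ⟨u, hu⟩, v, hv⟩ := hT p h1 _ h2
      have hp : (p : ℚ) ≠ 0 := by exact_mod_cast hP0 p (hsub h1)
      refine ⟨u / p, v / p, ?_, ?_⟩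
      · have hu' : (m : ℚ) ^ 3 + (p : ℚ) ^ 3 * (q₁ - q₂) = u ^ 3 := by exact_mod_cast hu
        simp only [hg, div_pow, ← hu']
        push_cast
        field_simp
      · have hv' : (m : ℚ) ^ 3 + (p : ℚ) ^ 3 * (q₁ - q₃) = v ^ 3 := by exact_mod_cast hv
        simp only [hg, div_pow, ← hv']
        push_cast
        field_simp
    have hfib' : ∀ x ∈ Y.image g, #{w ∈ Y | g w = x} ≤ Δ := by
      intro x hx
      obtain ⟨⟨p, m, f⟩, hw, rfl⟩ := mem_image.1 hx
      obtain ⟨h1, h2, rfl⟩ := hmem hw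
      refine le_trans ?_ (hT p h1 _ h2).2.1
      refine card_le_card_of_injOn (fun w => w.1) ?_ ?_
      · rintro ⟨p', m', f'⟩ hw'
        simp only [coe_filter, Set.mem_ofPred_eq, hg] at hw'
        obtain ⟨h1', h2', rfl⟩ := hmem hw'.1
        have hp' : (p' : ℚ) ≠ 0 := by exact_mod_cast hP0 p' (hsub h1')
        simp only [coe_filter, Set.mem_ofPred_eq]
        refine ⟨hsub h1', ?_⟩
        rw [← hw'.2, mul_div_cancel₀ _ hp']
        exact mem_image_of_mem _ (hT p' h1' _ h2').1.1
      · rintro ⟨p', m', f'⟩ hw' ⟨p'', m'', f''⟩ hw'' heq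
        simp only [coe_filter, Set.mem_ofPred_eq, hg] at hw' hw'' heq
        obtain ⟨h1', h2', rfl⟩ := hmem hw'.1
        obtain ⟨h1'', h2'', rfl⟩ := hmem hw''.1
        subst heq
        have hp' : (p' : ℚ) ≠ 0 := by exact_mod_cast hP0 p' (hsub h1')
        have h := hw'.2.trans hw''.2.symm
        rw [div_left_inj' hp'] at h
        have h' : m' = m'' := by exact_mod_cast h
        rw [h']
    calc #Y ≤ Δ * #(Y.image g) := card_le_mul_card_image _ _ hfib'
      _ ≤ Δ * C := Nat.mul_le_mul_left _ himg
      _ = C * Δ := mul_comm _ _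
  calc #W ≤ C * Δ * #(F ×ˢ F ×ˢ F) := card_le_mul_card_image_of_maps_to hmaps _ hfib
    _ = C * Δ * #F ^ 3 := by rw [card_product, card_product]; ring

/-- If `B` has small higher-order sumsets and contains a translate of many cubes, then averaging
over dilates by primes bounds the number of these cubes. -/
lemma card_cubes_pow_three_le {C : ℕ} (hU : UCube C) {c : ℤ} {M₀ B : Finset ℤ}
    (hne : M₀.Nonempty) (h0 : 0 ∉ M₀) (hMB : ∀ m ∈ M₀, m ^ 3 - c ∈ B)
    {L : ℝ} (hL : 2 ≤ L) {J m : ℕ} (hJ : 0 < J) (hm : 0 < m)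
    (h2 : (#(B + B) : ℝ) ≤ L ^ 2 * #B) (h4 : (#(B + B + B - B) : ℝ) ≤ L ^ 4 * #B)
    (h5 : (#(B + B + B - B - B) : ℝ) ≤ L ^ 5 * #B)
    (hexp : 64 * J * L ^ 4 ≤ Real.exp (m / (1024 * (J : ℝ) ^ 2)))
    {P : Finset ℕ} (hP : ∀ p ∈ P, p.Prime) (hPJ : ∀ p ∈ P, p ^ 3 < 2 ^ J)
    {Δ R l : ℕ} (hΔ : 0 < Δ) (hPR : #P = Δ * R) (hl : #M₀ * (1 + R) ≤ 2 ^ l)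
    (hlP : 4 * (l * (1 + R)) ≤ #P) (hn : 24 * L ^ (11 * m * J + 4) ≤ #M₀) :
    (R : ℝ) * (#M₀ : ℝ) ^ 3 ≤ 2048 * C * L ^ 8 * (#B : ℝ) ^ 2 := by
  obtain ⟨m₀, hm₀⟩ := hne
  have hB : B.Nonempty := ⟨_, hMB m₀ hm₀⟩
  obtain ⟨F, hF, hBF, hdil⟩ := exists_dilate_popular hB hL hJ hm h2 h4 h5 hexp
  set M : Finset ℚ := M₀.image (Int.cast : ℤ → ℚ) with hM
  have hMcard : #M = #M₀ := card_image_of_injective _ Int.cast_injective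
  have hgood := card_good_primes (P := P) (M := M) hP
    (by simpa [hM] using h0) ⟨_, mem_image_of_mem _ hm₀⟩ hPR.le (by rwa [hMcard]) hlP
  set P' := P.filter fun p : ℕ => #M ≤ 2 * #{m ∈ M | mulMult P M (m / p) ≤ Δ} with hP'
  set Mp : ℕ → Finset ℤ := fun p => {m ∈ M₀ | mulMult P M ((m : ℚ) / p) ≤ Δ} with hMp
  have hMpcard : ∀ p ∈ P', #M₀ ≤ 2 * #(Mp p) := by
    intro p hp
    have h := (mem_filter.1 hp).2
    rw [hMcard] at h
    refine h.trans (Nat.mul_le_mul_left _ ?_)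
    have : {m ∈ M | mulMult P M (m / p) ≤ Δ} ⊆ (Mp p).image (Int.cast : ℤ → ℚ) := by
      intro x hx
      rw [mem_filter, hM, mem_image] at hx
      obtain ⟨⟨z, hz, rfl⟩, hx⟩ := hx
      exact mem_image_of_mem _ (mem_filter.2 ⟨hz, hx⟩)
    exact (card_le_card this).trans card_image_le
  have hcube : Function.Injective (fun z : ℤ => z ^ 3 - c) := by
    intro x y hxy
    exact (Odd.strictMono_pow (by decide : Odd 3)).injective (sub_left_injective hxy)
  set A₁ : ℕ → Finset ℤ := fun p => (Mp p).image (fun z : ℤ => z ^ 3 - c) with hA₁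
  have hA₁card : ∀ p, #(A₁ p) = #(Mp p) := fun p => card_image_of_injective _ hcube
  set T : ℕ → Finset (ℤ × ℤ × ℤ × ℤ) := fun p => {t ∈ Mp p ×ˢ F ×ˢ F ×ˢ F |
    (t.2.1 ≠ t.2.2.1 ∧ t.2.1 ≠ t.2.2.2 ∧ t.2.2.1 ≠ t.2.2.2) ∧
    t.1 ^ 3 - c + ((p ^ 3 : ℕ) : ℤ) * (t.2.1 - t.2.2.1) ∈ A₁ p ∧
    t.1 ^ 3 - c + ((p ^ 3 : ℕ) : ℤ) * (t.2.1 - t.2.2.2) ∈ A₁ p} with hT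
  have hsum := sum_card_quadruples_le hU P P' (filter_subset _ _) (fun p hp => (hP p hp).ne_zero)
    M₀ F Δ T (by
      rintro p - ⟨z, q₁, q₂, q₃⟩ ht
      simp only [hT, hMp, hA₁, mem_filter, mem_product, mem_image] at ht
      obtain ⟨⟨⟨hz, hz'⟩, hq⟩, hd, ⟨u, -, hu⟩, v, -, hv⟩ := ht
      push_cast at hu hv
      refine ⟨⟨hz, by simpa only [mem_product] using hq⟩, hz', hd, ⟨u, ?_⟩, v, ?_⟩
      · linear_combination -hu
      · linear_combination -hv)
  have hL0 : 0 < L := by linarith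
  have hF0 : (0 : ℝ) < #F := by exact_mod_cast hF.card_pos
  have hlow : ∀ p ∈ P', ((#M₀ : ℝ) * #F / 4) ^ 3 ≤ 16 * (L ^ 4 * #B) ^ 2 * #(T p) := by
    intro p hp
    obtain ⟨V, hV, hS⟩ := hdil (p ^ 3) (hPJ p (mem_filter.1 hp).1) (A₁ p) (by
      intro a ha
      obtain ⟨z, hz, rfl⟩ := mem_image.1 ha
      exact hMB z (mem_filter.1 hz).1)
    have hMp' : (#M₀ : ℝ) ≤ 2 * #(A₁ p) := by
      rw [hA₁card]; exact_mod_cast hMpcard p hp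
    have hS' : (#(A₁ p) : ℝ) * #F ≤
        2 * #{q ∈ A₁ p ×ˢ F | q.1 + ((p ^ 3 : ℕ) : ℤ) * q.2 ∈ V} := by exact_mod_cast hS
    have hSlow : (#M₀ : ℝ) * #F / 4 ≤
        #{q ∈ A₁ p ×ˢ F | q.1 + ((p ^ 3 : ℕ) : ℤ) * q.2 ∈ V} := by
      have := mul_le_mul_of_nonneg_right hMp' hF0.le
      linarith
    have hVS : 6 * (#V : ℝ) ≤ #{q ∈ A₁ p ×ˢ F | q.1 + ((p ^ 3 : ℕ) : ℤ) * q.2 ∈ V} := by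
      refine le_trans ?_ hSlow
      have h1 : L ^ 4 * #B ≤ L ^ 4 * (L ^ (11 * m * J) * #F) := by gcongr
      have h3 := mul_le_mul_of_nonneg_right hn hF0.le
      rw [pow_add] at h3
      nlinarith
    have h6 := card_incidences_pow_three_le (A₁ p) F V ((p ^ 3 : ℕ) : ℤ) (by exact_mod_cast hVS)
    have hTle : #{t ∈ A₁ p ×ˢ F ×ˢ F ×ˢ F |
        (t.2.1 ≠ t.2.2.1 ∧ t.2.1 ≠ t.2.2.2 ∧ t.2.2.1 ≠ t.2.2.2) ∧
        t.1 + ((p ^ 3 : ℕ) : ℤ) * (t.2.1 - t.2.2.1) ∈ A₁ p ∧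
        t.1 + ((p ^ 3 : ℕ) : ℤ) * (t.2.1 - t.2.2.2) ∈ A₁ p} ≤ #(T p) := by
      refine le_trans (card_le_card (t := (T p).image fun t => (t.1 ^ 3 - c, t.2)) ?_)
        card_image_le
      rintro ⟨a, q₁, q₂, q₃⟩ ht
      simp only [mem_filter, mem_product] at ht
      obtain ⟨⟨ha, hq⟩, hrest⟩ := ht
      obtain ⟨z, hz, rfl⟩ := mem_image.1 ha
      refine mem_image.2 ⟨(z, q₁, q₂, q₃), ?_, rfl⟩
      simp only [hT, mem_filter, mem_product]
      exact ⟨⟨hz, hq⟩, hrest⟩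
    refine (pow_le_pow_left₀ (by positivity) hSlow 3).trans (h6.trans ?_)
    have hTle' := (Nat.cast_le (α := ℝ)).2 hTle
    gcongr
  have htot : (#P' : ℝ) * ((#M₀ : ℝ) * #F / 4) ^ 3 ≤
      16 * (L ^ 4 * #B) ^ 2 * (C * Δ * (#F : ℝ) ^ 3) := by
    have h := sum_le_sum hlow
    rw [sum_const, nsmul_eq_mul, ← mul_sum] at h
    refine h.trans ?_
    gcongr
    exact_mod_cast hsum
  have hΔ0 : (0 : ℝ) < Δ := by exact_mod_cast hΔ
  have hP'low : (Δ : ℝ) * R ≤ 2 * #P' := by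
    rw [hPR] at hgood; exact_mod_cast hgood
  have hfin : (Δ * (#F : ℝ) ^ 3) * ((R : ℝ) * (#M₀ : ℝ) ^ 3) ≤
      (Δ * (#F : ℝ) ^ 3) * (2048 * C * L ^ 8 * (#B : ℝ) ^ 2) := by
    have h := mul_le_mul_of_nonneg_right hP'low
      (by positivity : 0 ≤ ((#M₀ : ℝ) * #F / 4) ^ 3)
    calc (Δ * (#F : ℝ) ^ 3) * ((R : ℝ) * (#M₀ : ℝ) ^ 3)
        = 64 * (Δ * R * ((#M₀ : ℝ) * #F / 4) ^ 3) := by ring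
      _ ≤ 64 * (2 * (16 * (L ^ 4 * #B) ^ 2 * (C * Δ * (#F : ℝ) ^ 3))) := by nlinarith
      _ = _ := by ring
  exact le_of_mul_le_mul_left hfin (by positivity)

/-- The Plünnecke–Ruzsa inequality for a set of small difference set. -/
lemma card_nsmul_sub_nsmul_le {B : Finset ℤ} (hB : B.Nonempty) {L : ℝ}
    (h : (#(B - B) : ℝ) ≤ L * #B) (m n : ℕ) : (#(m • B - n • B) : ℝ) ≤ L ^ (m + n) * #B := by
  have hB0 : (0 : ℝ) < #B := by exact_mod_cast hB.card_pos
  have hpl := pluennecke_ruzsa_inequality_nsmul_sub_nsmul_sub hB B m n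
  have hpl' : (#(m • B - n • B) : ℝ) ≤ ((#(B - B) : ℝ) / #B) ^ (m + n) * #B := by
    have h' := (NNRat.cast_le (K := ℝ)).2 hpl
    push_cast at h'
    exact h'
  refine hpl'.trans ?_
  gcongr
  rwa [div_le_iff₀ hB0]

/-- If every element of `B` is a popular difference of a set `A` of cubes, then some translate of
`B` contains many elements of `A`. -/
lemma exists_cube_roots {A B : Finset ℤ} (hA : ∀ a ∈ A, ∃ m : ℤ, a = m ^ 3) (hAne : A.Nonempty)
    {t : ℝ} (hB : ∀ x ∈ B, t ≤ diffRep A x) :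
    ∃ (c : ℤ) (M₀ : Finset ℤ), 0 ∉ M₀ ∧ (∀ m ∈ M₀, m ^ 3 - c ∈ B) ∧ #M₀ ≤ #A ∧
      t * #B ≤ #A * (#M₀ + 1 : ℝ) := by
  have hsum : ∑ x ∈ B, diffRep A x = ∑ c ∈ A, #{x ∈ B | c + x ∈ A} := by
    simp only [diffRep, card_filter]
    exact sum_comm
  have hlow : t * #B ≤ ∑ c ∈ A, (#{x ∈ B | c + x ∈ A} : ℝ) := by
    have h := sum_le_sum hB
    rw [sum_const, nsmul_eq_mul, mul_comm] at h
    exact h.trans (by exact_mod_cast hsum.le)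
  obtain ⟨c, -, hc⟩ := exists_max_image A (fun c => #{x ∈ B | c + x ∈ A}) hAne
  choose! r hr using hA
  have hr' : ∀ a ∈ A, r a ^ 3 = a := fun a ha => (hr a ha).symm
  set X := {x ∈ B | c + x ∈ A} with hX
  have hinj : Set.InjOn (fun x => r (c + x)) (X : Set ℤ) := by
    intro x hx y hy hxy
    have hx' := (mem_filter.1 (mem_coe.1 hx)).2
    have hy' := (mem_filter.1 (mem_coe.1 hy)).2
    have h := hr' _ hx'
    simp only at hxy
    rw [hxy, hr' _ hy'] at h
    linarith
  refine ⟨c, (X.image fun x => r (c + x)).erase 0, notMem_erase _ _, ?_, ?_, ?_⟩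
  · intro m hm
    obtain ⟨x, hx, rfl⟩ := mem_image.1 (mem_of_mem_erase hm)
    rw [hr' _ (mem_filter.1 hx).2, add_sub_cancel_left]
    exact (mem_filter.1 hx).1
  · refine (card_le_card (erase_subset _ _)).trans (card_image_le.trans ?_)
    exact card_le_card_of_injOn (fun x => c + x) (fun x hx => (mem_filter.1 (mem_coe.1 hx)).2)
      (fun x _ y _ h => add_left_cancel h)
  · have hcard : #X ≤ #((X.image fun x => r (c + x)).erase 0) + 1 := by
      rw [← card_image_of_injOn hinj]
      exact Nat.sub_le_iff_le_add.1 pred_card_le_card_erase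
    refine hlow.trans ((sum_le_sum (g := fun _ => (#X : ℝ)) fun a ha => by
      exact_mod_cast hc a ha).trans ?_)
    rw [sum_const, nsmul_eq_mul]
    gcongr
    exact_mod_cast hcard

/-- There are at least `2 ^ (b * ℓ)` primes up to `2 ^ ((b + 4) * ℓ)`. -/
lemma exists_primes {b ℓ : ℕ} (hℓ : 6 ≤ ℓ) (hb : 0 < b) (hb' : b + 4 ≤ 2 ^ 16) :
    ∃ P : Finset ℕ, (∀ p ∈ P, p.Prime) ∧ (∀ p ∈ P, p ≤ 2 ^ ((b + 4) * ℓ)) ∧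
      #P = 2 ^ (b * ℓ) := by
  set N := (b + 4) * ℓ with hN
  have hπ := Chebyshev.pi_ge (2 ^ N)
  have hlog2 : 0 < Real.log 2 := Real.log_pos (by norm_num)
  have hN0 : (0 : ℝ) < N := by
    have : 0 < N := by positivity
    exact_mod_cast this
  have hcount : 2 ^ (b * ℓ) ≤ (2 ^ N).primeCounting := by
    have h1 : Real.log (2 ^ N + 1) ≤ (N + 1) * Real.log 2 := by
      rw [← Nat.cast_succ, ← Real.log_pow]
      refine Real.log_le_log (by positivity) ?_
      rw [pow_succ]
      have : (1 : ℝ) ≤ 2 ^ N := one_le_pow₀ (by norm_num)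
      linarith
    have h2 : (2 : ℝ) ^ N - (N + 1) ≤ N * (2 ^ N).primeCounting := by
      push_cast at hπ
      rw [Real.log_pow, div_le_iff₀ (by positivity)] at hπ
      have : ((2 : ℝ) ^ N - (N + 1)) * Real.log 2 ≤
          (N * (2 ^ N).primeCounting) * Real.log 2 := by nlinarith
      exact le_of_mul_le_mul_right this hlog2
    have h3 : N * 2 ^ (b * ℓ) + N + 1 ≤ 2 ^ N := by
      have e1 : 2 ^ N = 2 ^ (b * ℓ) * (2 ^ ℓ * 2 ^ (3 * ℓ)) := by
        rw [hN, ← pow_add, ← pow_add]; congr 1; ring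
      have e2 : ℓ < 2 ^ ℓ := Nat.lt_two_pow_self
      have e3 : 2 ^ 18 ≤ 2 ^ (3 * ℓ) := Nat.pow_le_pow_right (by norm_num) (by omega)
      have e4 : N ≤ 2 ^ 16 * ℓ := Nat.mul_le_mul_right _ hb'
      have e5 : 1 ≤ 2 ^ (b * ℓ) := Nat.one_le_two_pow
      have e6 : ℓ * 2 ^ 18 ≤ 2 ^ ℓ * 2 ^ (3 * ℓ) := Nat.mul_le_mul e2.le e3
      rw [e1]
      have e7 : 3 * N ≤ 2 ^ ℓ * 2 ^ (3 * ℓ) := by omega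
      have e8 := Nat.mul_le_mul_left (2 ^ (b * ℓ)) e7
      have e9 : N ≤ N * 2 ^ (b * ℓ) := Nat.le_mul_of_pos_right _ e5
      have e10 : 1 ≤ N := by exact_mod_cast hN0
      nlinarith
    have h3' : (N : ℝ) * 2 ^ (b * ℓ) + N + 1 ≤ 2 ^ N := by exact_mod_cast h3
    have h4 : (N : ℝ) * 2 ^ (b * ℓ) ≤ N * (2 ^ N).primeCounting := by linarith
    exact_mod_cast le_of_mul_le_mul_left h4 hN0
  have hc : 2 ^ (b * ℓ) ≤ #{p ∈ range (2 ^ N + 1) | p.Prime} := by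
    rwa [← Nat.count_eq_card_filter_range]
  obtain ⟨P, hsub, hP⟩ := exists_subset_card_eq hc
  refine ⟨P, fun p hp => (mem_filter.1 (hsub hp)).2, fun p hp => ?_, hP⟩
  exact Nat.lt_succ_iff.1 (mem_range.1 (mem_filter.1 (hsub hp)).1)

/-- A set of cubes of large energy has many elements in a translate of a set of small doubling. -/
lemma exists_cubes_in_small_doubling {C : ℕ} (hU : UCube C) {A : Finset ℤ}
    (hA : ∀ a ∈ A, ∃ m : ℤ, a = m ^ 3) {κ s : ℝ} (hκ : 64 ≤ κ) (hCκ : C ≤ κ) (hs : s ^ 2 = #A)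
    (hsκ : κ ^ 17 ≤ s) (hE : s ^ 5 ≤ κ * _root_.addEnergy A) :
    ∃ (c : ℤ) (M₀ B : Finset ℤ), M₀.Nonempty ∧ 0 ∉ M₀ ∧ (∀ m ∈ M₀, m ^ 3 - c ∈ B) ∧
      #M₀ ≤ #A ∧ s ^ 2 ≤ κ ^ 34 * #M₀ ∧ #B ≤ κ ^ 6 * s ^ 3 ∧
      (#(B - B) : ℝ) ≤ κ ^ 128 * #B := by
  have hκ0 : 0 < κ := by linarith
  have hκ1 : 1 ≤ κ := by linarith
  have hs0 : 0 < s := lt_of_lt_of_le (by positivity) hsκ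
  have hAne : A.Nonempty := by
    rw [← card_pos]
    have : (0 : ℝ) < #A := by rw [← hs]; positivity
    exact_mod_cast this
  obtain ⟨D, hDpop, hDcard, hDG⟩ := exists_popular_differences
    (fun x y hx hy hxy => hU.card_triple_le hA hx hy hxy) hκ hCκ hs
    ((pow_le_pow_right₀ hκ1 (by norm_num)).trans hsκ) hE
  set G := {p ∈ D ×ˢ D | p.1 - p.2 ∈ D} with hG
  have hGD : (#G : ℝ) ≤ (#D : ℝ) ^ 2 := by
    have : #G ≤ #D ^ 2 := by
      rw [sq, ← card_product]; exact card_filter_le _ _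
    exact_mod_cast this
  have hDlow : s ^ 3 ≤ κ ^ 5 * #D := by
    refine (pow_le_pow_iff_left₀ (by positivity) (by positivity) two_ne_zero).1 ?_
    calc (s ^ 3) ^ 2 = s ^ 6 := by ring
      _ ≤ κ ^ 9 * #D ^ 2 := hDG.trans (by gcongr)
      _ ≤ κ ^ 10 * #D ^ 2 := by gcongr; norm_num
      _ = (κ ^ 5 * #D) ^ 2 := by ring
  have hDne : D.Nonempty := by
    rw [nonempty_iff_ne_empty]
    rintro rfl
    have : 0 < s ^ 3 := by positivity
    simp at hDlow
    linarith
  obtain ⟨B, hBD, hDB, hBB⟩ := exists_small_doubling hDne (K := κ ^ 21) (one_le_pow₀ hκ1) (by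
    calc (#D : ℝ) ^ 2 ≤ (κ ^ 6 * s ^ 3) ^ 2 := by gcongr
      _ = κ ^ 12 * s ^ 6 := by ring
      _ ≤ κ ^ 12 * (κ ^ 9 * #G) := by gcongr
      _ = κ ^ 21 * #G := by ring)
  have hBlow : s ^ 3 ≤ κ ^ 27 * #B := by
    calc s ^ 3 ≤ κ ^ 5 * (4 * κ ^ 21 * #B) := hDlow.trans (by gcongr)
      _ = 4 * (κ ^ 26 * #B) := by ring
      _ ≤ κ * (κ ^ 26 * #B) := by gcongr; linarith
      _ = κ ^ 27 * #B := by ring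
  obtain ⟨c, M₀, h0, hMB, hMA, hBM⟩ := exists_cube_roots (B := B) hA hAne (t := s / κ ^ 6)
    (fun x hx => by
      rw [div_le_iff₀ (by positivity), mul_comm]
      exact hDpop x (hBD hx))
  have hM1 : s ^ 2 ≤ κ ^ 33 * (#M₀ + 1) := by
    have h : s ^ 2 * s ^ 2 ≤ s ^ 2 * (κ ^ 33 * (#M₀ + 1)) := by
      calc s ^ 2 * s ^ 2 = s * s ^ 3 := by ring
        _ ≤ s * (κ ^ 27 * #B) := by gcongr
        _ = κ ^ 33 * (s / κ ^ 6 * #B) := by field_simp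
        _ ≤ κ ^ 33 * (#A * (#M₀ + 1)) := by gcongr
        _ = s ^ 2 * (κ ^ 33 * (#M₀ + 1)) := by rw [← hs]; ring
    exact le_of_mul_le_mul_left h (by positivity)
  have hMne : M₀.Nonempty := by
    rw [nonempty_iff_ne_empty]
    rintro rfl
    simp only [card_empty, Nat.cast_zero, zero_add, mul_one] at hM1
    have h1 : (κ ^ 17) ^ 2 ≤ s ^ 2 := by gcongr
    have h2 : κ ^ 33 < κ ^ 34 := pow_lt_pow_right₀ (by linarith) (by norm_num)
    rw [← pow_mul] at h1
    exact (h2.trans_le h1).not_ge hM1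
  have hM1' : (1 : ℝ) ≤ #M₀ := by exact_mod_cast hMne.card_pos
  refine ⟨c, M₀, B, hMne, h0, hMB, hMA, ?_, ?_, ?_⟩
  · calc s ^ 2 ≤ κ ^ 33 * (#M₀ + 1) := hM1
      _ ≤ κ ^ 33 * (κ * #M₀) := by gcongr; nlinarith
      _ = κ ^ 34 * #M₀ := by ring
  · refine le_trans ?_ hDcard
    exact_mod_cast card_le_card hBD
  · refine hBB.trans ?_
    calc 2048 * (κ ^ 21) ^ 6 * #B ≤ κ ^ 2 * (κ ^ 21) ^ 6 * #B := by gcongr; nlinarith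
      _ = κ ^ 128 * #B := by ring

/-- Sets of cubes with `2 ^ (c₀ ℓ⁵) ≤ |A| ≤ 2 ^ (2 ^ ℓ)` gain a factor `2 ^ ℓ` over the trivial
energy bound. -/
lemma exists_two_pow_mul_addEnergy_lt : ∃ c₀ : ℕ, ∀ C : ℕ, UCube C → ∀ ℓ : ℕ, 6 ≤ ℓ → C ≤ 2 ^ ℓ →
    ∀ A : Finset ℤ, (∀ a ∈ A, ∃ m : ℤ, a = m ^ 3) → 2 ^ (c₀ * ℓ ^ 5) ≤ #A → #A ≤ 2 ^ 2 ^ ℓ →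
      ∀ s : ℝ, 0 ≤ s → s ^ 2 = #A → 2 ^ ℓ * (_root_.addEnergy A : ℝ) < s ^ 5 := by
  refine ⟨547 + 1408 * 614400 * 3451 ^ 3, fun C hU ℓ hℓ hC A hA hlow hup s hs0 hs => ?_⟩
  by_contra! hE
  set κ : ℝ := 2 ^ ℓ with hκ
  clear_value κ
  have hκ64 : 64 ≤ κ := by
    have : (2 : ℝ) ^ 6 ≤ 2 ^ ℓ := pow_le_pow_right₀ (by norm_num) hℓ
    linarith
  have hκ0 : 0 < κ := by linarith
  have hκ1 : 1 ≤ κ := by linarith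
  have hCκ : (C : ℝ) ≤ κ := by rw [hκ]; exact_mod_cast hC
  obtain ⟨J, hJ⟩ : ∃ J, J = 3451 * ℓ := ⟨_, rfl⟩
  obtain ⟨m, hm⟩ : ∃ m, m = 614400 * ℓ * J ^ 2 := ⟨_, rfl⟩
  have hlow' : κ ^ (35 + 128 * (11 * m * J + 4)) ≤ s ^ 2 := by
    rw [hs, hκ, ← pow_mul]
    refine le_trans (pow_le_pow_right₀ (by norm_num) ?_) (by exact_mod_cast hlow)
    have h5 : ℓ ≤ ℓ ^ 5 := Nat.le_self_pow (by norm_num) ℓ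
    have : ℓ * (35 + 128 * (11 * m * J + 4)) = 547 * ℓ + 1408 * 614400 * 3451 ^ 3 * ℓ ^ 5 := by
      rw [hm, hJ]; ring
    rw [this, add_mul]
    gcongr
  have hsκ : κ ^ 17 ≤ s := by
    refine (pow_le_pow_iff_left₀ (by positivity) hs0 two_ne_zero).1 ?_
    rw [← pow_mul]
    exact (pow_le_pow_right₀ hκ1 (by omega)).trans hlow'
  have hs0' : 0 < s := lt_of_lt_of_le (by positivity) hsκ
  obtain ⟨c, M₀, B, hMne, h0, hMB, hMA, hM, hBup, hBB⟩ :=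
    exists_cubes_in_small_doubling hU hA hκ64 hCκ hs hsκ hE
  have hBne : B.Nonempty := ⟨_, hMB _ hMne.choose_spec⟩
  have hpl := card_nsmul_sub_nsmul_le hBne hBB
  obtain ⟨P, hP, hPle, hPcard⟩ := exists_primes (b := 1146) hℓ (by norm_num) (by norm_num)
  have hJ0 : 0 < J := by omega
  have hm0 : 0 < m := by rw [hm]; positivity
  have hexp : 64 * J * (κ ^ 128) ^ 4 ≤ Real.exp (m / (1024 * (J : ℝ) ^ 2)) := by
    have h1 : (m : ℝ) / (1024 * (J : ℝ) ^ 2) = (600 * ℓ : ℕ) := by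
      have : (J : ℝ) ≠ 0 := by exact_mod_cast hJ0.ne'
      rw [hm]
      push_cast
      field_simp
      norm_num
    have h2 : (J : ℝ) ≤ κ ^ 3 := by
      have h : (ℓ : ℝ) ≤ κ := by
        have := (Nat.lt_two_pow_self (n := ℓ)).le
        rw [hκ]; exact_mod_cast this
      rw [hJ]
      push_cast
      calc 3451 * (ℓ : ℝ) ≤ 64 ^ 2 * κ := by linarith
        _ ≤ κ ^ 2 * κ := by gcongr
        _ = κ ^ 3 := by ring
    rw [h1, ← Real.exp_one_pow]
    calc 64 * J * (κ ^ 128) ^ 4 ≤ κ * κ ^ 3 * (κ ^ 128) ^ 4 := by gcongr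
      _ = κ ^ 516 := by ring
      _ ≤ κ ^ 600 := pow_le_pow_right₀ hκ1 (by norm_num)
      _ = 2 ^ (600 * ℓ) := by rw [hκ, ← pow_mul, mul_comm]
      _ ≤ Real.exp 1 ^ (600 * ℓ) := by
        gcongr
        have := Real.add_one_le_exp (1 : ℝ)
        linarith
  have hmain := card_cubes_pow_three_le hU (c := c) hMne h0 hMB (L := κ ^ 128)
    ((by linarith : 2 ≤ κ).trans (le_self_pow₀ hκ1 (by norm_num))) hJ0 hm0
    (by simpa [two_nsmul] using hpl 2 0)
    (by simpa [succ_nsmul] using hpl 3 1)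
    (by simpa [succ_nsmul, sub_sub] using hpl 3 2) hexp hP
    (fun p hp => by
      calc p ^ 3 ≤ (2 ^ ((1146 + 4) * ℓ)) ^ 3 := Nat.pow_le_pow_left (hPle p hp) 3
        _ = 2 ^ (3450 * ℓ) := by rw [← pow_mul]; congr 1; ring
        _ < 2 ^ J := Nat.pow_lt_pow_right (by norm_num) (by omega))
    (Δ := 2 ^ (4 * ℓ)) (R := 2 ^ (1142 * ℓ)) (l := 2 ^ ℓ + (1142 * ℓ + 1)) (by positivity)
    (by rw [hPcard, ← pow_add]; congr 1; ring)
    (by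
      rw [pow_add]
      refine Nat.mul_le_mul (hMA.trans hup) ?_
      have : 1 ≤ 2 ^ (1142 * ℓ) := Nat.one_le_two_pow
      rw [pow_succ]; omega)
    (by
      have h1 : ℓ < 2 ^ ℓ := Nat.lt_two_pow_self
      have h2 : 1 ≤ 2 ^ (1142 * ℓ) := Nat.one_le_two_pow
      have h3 : 2 ^ 18 * 2 ^ ℓ ≤ 2 ^ (4 * ℓ) := by
        rw [← pow_add]; exact Nat.pow_le_pow_right (by norm_num) (by omega)
      have h4 : 8 * (2 ^ ℓ + (1142 * ℓ + 1)) ≤ 2 ^ (4 * ℓ) := by omega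
      calc 4 * ((2 ^ ℓ + (1142 * ℓ + 1)) * (1 + 2 ^ (1142 * ℓ)))
          ≤ 4 * ((2 ^ ℓ + (1142 * ℓ + 1)) * (2 * 2 ^ (1142 * ℓ))) := by gcongr; omega
        _ = 8 * (2 ^ ℓ + (1142 * ℓ + 1)) * 2 ^ (1142 * ℓ) := by ring
        _ ≤ 2 ^ (4 * ℓ) * 2 ^ (1142 * ℓ) := by gcongr
        _ = #P := by rw [hPcard, ← pow_add]; congr 1; ring)
    (by
      have h : κ ^ 34 * (24 * (κ ^ 128) ^ (11 * m * J + 4)) ≤ κ ^ 34 * #M₀ := by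
        refine le_trans ?_ (hlow'.trans hM)
        rw [← pow_mul, show 35 + 128 * (11 * m * J + 4) = 34 + (1 + 128 * (11 * m * J + 4)) by omega,
          pow_add κ 34, pow_add κ 1, pow_one]
        have : 24 ≤ κ := by linarith
        gcongr
      exact le_of_mul_le_mul_left h (by positivity))
  push_cast at hmain
  rw [mul_comm 1142 ℓ, pow_mul, ← hκ] at hmain
  have hlt : κ ^ 1141 * s ^ 6 < κ ^ 1142 * s ^ 6 := by
    gcongr
    · linarith
    · norm_num
  refine hlt.not_ge ?_
  calc κ ^ 1142 * s ^ 6 = κ ^ 1142 * (s ^ 2) ^ 3 := by ring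
    _ ≤ κ ^ 1142 * (κ ^ 34 * #M₀) ^ 3 := by gcongr
    _ = κ ^ 102 * (κ ^ 1142 * (#M₀ : ℝ) ^ 3) := by ring
    _ ≤ κ ^ 102 * (2048 * C * (κ ^ 128) ^ 8 * (#B : ℝ) ^ 2) := by gcongr
    _ ≤ κ ^ 102 * (κ ^ 2 * κ * (κ ^ 128) ^ 8 * (κ ^ 6 * s ^ 3) ^ 2) := by gcongr; nlinarith
    _ = κ ^ 1141 * s ^ 6 := by ring

lemma addEnergy_le_card_pow_three (A : Finset ℤ) : (_root_.addEnergy A : ℝ) ≤ (#A : ℝ) ^ 3 := by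
  rw [addEnergy_eq_sum_pairs]
  refine (sum_le_sum (g := fun _ => (#A : ℝ) * #A) fun a _ =>
    (sum_le_sum (g := fun _ => (#A : ℝ)) fun b _ => ?_).trans_eq ?_).trans_eq ?_
  · exact_mod_cast diffRep_le_card A _
  · rw [sum_const, nsmul_eq_mul]
  · rw [sum_const, nsmul_eq_mul]; ring

open Filter in
/-- The constraints relating `ℓ = ⌈x ^ α⌉` to `x = log |A|` hold eventually if `5 α < 1`. -/
lemma eventually_ceil_rpow_bounds {α : ℝ} (hα : 0 < α) (hα' : α < 1 / 5) (C c₀ : ℕ) :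
    ∀ᶠ x : ℝ in atTop, 6 ≤ ⌈x ^ α⌉₊ ∧ C ≤ ⌈x ^ α⌉₊ ∧
      (c₀ * ⌈x ^ α⌉₊ ^ 5 : ℕ) * Real.log 2 ≤ x ∧ x ≤ (2 ^ ⌈x ^ α⌉₊ : ℕ) * Real.log 2 := by
  have hlog2 : 0 < Real.log 2 := Real.log_pos (by norm_num)
  have hy : Tendsto (fun x : ℝ => x ^ α) atTop atTop := tendsto_rpow_atTop hα
  have hz : Tendsto (fun x : ℝ => x ^ (1 - 5 * α)) atTop atTop :=
    tendsto_rpow_atTop (by linarith)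
  have hw := hy.eventually ((isLittleO_rpow_exp_pos_mul_atTop α⁻¹ hlog2).bound hlog2)
  filter_upwards [hy.eventually_ge_atTop 6, hy.eventually_ge_atTop C,
    hz.eventually_ge_atTop (32 * c₀), hw, eventually_gt_atTop 0] with x h6 hC hz hw hx
  have hceil := Nat.le_ceil (x ^ α)
  refine ⟨by exact_mod_cast h6.trans hceil, by exact_mod_cast hC.trans hceil, ?_, ?_⟩
  · have hup : (⌈x ^ α⌉₊ : ℝ) ≤ 2 * x ^ α := by
      have := Nat.ceil_lt_add_one (a := x ^ α) (by linarith)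
      linarith
    have hx5 : (x ^ α) ^ 5 * x ^ (1 - 5 * α) = x := by
      rw [← Real.rpow_mul_natCast hx.le, ← Real.rpow_add hx]
      convert Real.rpow_one x using 2
      push_cast; ring
    have hlog1 : Real.log 2 ≤ 1 := by
      have := Real.log_two_lt_d9; linarith
    push_cast
    calc (c₀ : ℝ) * (⌈x ^ α⌉₊ : ℝ) ^ 5 * Real.log 2 ≤ c₀ * (2 * x ^ α) ^ 5 * 1 := by gcongr
      _ = (x ^ α) ^ 5 * (32 * c₀) := by ring
      _ ≤ (x ^ α) ^ 5 * x ^ (1 - 5 * α) := by gcongr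
      _ = x := hx5
  · rw [← Real.rpow_mul hx.le, mul_inv_cancel₀ hα.ne', Real.rpow_one, Real.norm_of_nonneg hx.le,
      Real.norm_of_nonneg (Real.exp_pos _).le, ← Real.rpow_def_of_pos (by norm_num)] at hw
    refine hw.trans ?_
    rw [mul_comm]
    push_cast
    gcongr
    rw [← Real.rpow_natCast]
    exact Real.rpow_le_rpow_of_exponent_le (by norm_num) hceil

/-- conditionally, for any `0 < α < 1/11` the additive energy of a set of
cubes satisfies `E(A) ≤ C₀·|A|^{5/2}·exp(−c·(log |A|)^α)`. -/
theorem cubes_energy (C : ℕ) (hC : 1 ≤ C) (hU : UCube C) :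
    ∀ α : ℝ, 0 < α → α < 1 / 11 →
      ∃ c C₀ : ℝ, 0 < c ∧ 1 ≤ C₀ ∧
        ∀ (A : Finset ℤ), (∀ a ∈ A, ∃ m : ℤ, a = m ^ 3) → 2 ≤ A.card →
          (addEnergy A : ℝ) ≤
            C₀ * (A.card : ℝ) ^ ((5 : ℝ) / 2) *
              Real.exp (-c * Real.log (A.card : ℝ) ^ α) := by
  obtain ⟨c₀, hmain⟩ := exists_two_pow_mul_addEnergy_lt
  intro α hα hα'
  obtain ⟨X, hX⟩ := Filter.eventually_atTop.1
    (eventually_ceil_rpow_bounds hα (by linarith) C c₀)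
  have hlog2 : 0 < Real.log 2 := Real.log_pos (by norm_num)
  set Y := max X 0 with hY
  have hY0 : 0 ≤ Y := le_max_right _ _
  have hYα : 0 ≤ Y ^ α := Real.rpow_nonneg hY0 α
  refine ⟨Real.log 2, Real.exp (3 * Y + Real.log 2 * Y ^ α), hlog2,
    Real.one_le_exp (by positivity), fun A hA hcard => ?_⟩
  have hn2 : (2 : ℝ) ≤ #A := by exact_mod_cast hcard
  have hn0 : (0 : ℝ) < #A := by linarith
  set x := Real.log #A with hx
  have hx0 : 0 ≤ x := Real.log_nonneg (by linarith)
  have hnx : Real.exp x = #A := Real.exp_log hn0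
  rcases le_total Y x with hYx | hYx
  · obtain ⟨h6, hCℓ, hlow, hup⟩ := hX x ((le_max_left _ _).trans hYx)
    set ℓ := ⌈x ^ α⌉₊ with hℓ
    have hlow' : 2 ^ (c₀ * ℓ ^ 5) ≤ #A := by
      rw [hx, ← Real.log_pow] at hlow
      exact_mod_cast (Real.log_le_log_iff (by positivity) hn0).1 hlow
    have hup' : #A ≤ 2 ^ 2 ^ ℓ := by
      rw [hx, ← Real.log_pow] at hup
      exact_mod_cast (Real.log_le_log_iff hn0 (by positivity)).1 hup
    have h := hmain C hU ℓ h6 (hCℓ.trans Nat.lt_two_pow_self.le) A hA hlow' hup'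
      (√(#A : ℝ)) (Real.sqrt_nonneg _) (Real.sq_sqrt hn0.le)
    have hs : √(#A : ℝ) ^ 5 = (#A : ℝ) ^ ((5 : ℝ) / 2) := by
      rw [Real.sqrt_eq_rpow, ← Real.rpow_mul_natCast hn0.le]
      norm_num
    have hexp : Real.exp (x ^ α * Real.log 2) ≤ 2 ^ ℓ := by
      rw [mul_comm, ← Real.rpow_def_of_pos (by norm_num), ← Real.rpow_natCast]
      exact Real.rpow_le_rpow_of_exponent_le (by norm_num) (Nat.le_ceil _)
    have hE : (_root_.addEnergy A : ℝ) ≤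
        (#A : ℝ) ^ ((5 : ℝ) / 2) * Real.exp (-Real.log 2 * x ^ α) := by
      rw [show -Real.log 2 * x ^ α = -(x ^ α * Real.log 2) by ring, Real.exp_neg,
        ← div_eq_mul_inv, le_div_iff₀ (Real.exp_pos _), ← hs, mul_comm]
      exact (mul_le_mul_of_nonneg_right hexp (Nat.cast_nonneg _)).trans h.le
    rw [mul_assoc]
    exact hE.trans (le_mul_of_one_le_left (by positivity) (Real.one_le_exp (by positivity)))
  · have h1 : (1 : ℝ) ≤ (#A : ℝ) ^ ((5 : ℝ) / 2) :=
      Real.one_le_rpow (by linarith) (by norm_num)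
    have h2 : x ^ α ≤ Y ^ α := Real.rpow_le_rpow hx0 hYx hα.le
    calc (_root_.addEnergy A : ℝ) ≤ (#A : ℝ) ^ 3 := addEnergy_le_card_pow_three A
      _ = Real.exp (3 * x) := by
          rw [← hnx, ← Real.exp_nat_mul]; norm_num
      _ ≤ Real.exp (3 * Y + Real.log 2 * Y ^ α + -Real.log 2 * x ^ α) := by
          gcongr; nlinarith
      _ = Real.exp (3 * Y + Real.log 2 * Y ^ α) * 1 * Real.exp (-Real.log 2 * x ^ α) := by
          rw [mul_one, Real.exp_add]
      _ ≤ Real.exp (3 * Y + Real.log 2 * Y ^ α) * (#A : ℝ) ^ ((5 : ℝ) / 2) *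
          Real.exp (-Real.log 2 * x ^ α) := by gcongr
end

section
/- Let k ≥ 4 be an integer and C ≥ 1 a constant. Then there exists a constant K ≥ 1 depending only on k and C such that the following holds. Let G be an abelian group in which every nonzero element has (additive) order at least k, and let A ⊆ G be a finite set such that |A ∩ (A + α₁) ∩ ⋯ ∩ (A + α_{k−1})| ≤ C for all pairwise distinct nonzero α₁, …, α_{k−1} ∈ G. Then Σ_{(s,t) ∈ G×G} |A ∩ (A + s) ∩ (A + t)|^k ≤ K·|A|^k. -/
open Finset Pointwise

theorem Nat.pow_le_pow_mul_descFactorial_add (k g : ℕ) (hk : 1 ≤ k) :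
    g ^ k ≤ k ^ k * (g.descFactorial k + g) := by
  rcases Nat.eq_zero_or_pos g with rfl | hg
  · simp [Nat.zero_pow hk]
  rcases lt_or_ge g k with h | h
  · calc g ^ k ≤ k ^ k * 1 := by simpa using Nat.pow_le_pow_left h.le k
      _ ≤ _ := by gcongr; omega
  · obtain ⟨d, rfl⟩ := Nat.exists_eq_add_of_le h
    have h1 : k + d ≤ k * (k + d + 1 - k) := by
      rw [show k + d + 1 - k = d + 1 by omega]
      nlinarith
    calc (k + d) ^ k ≤ (k * (k + d + 1 - k)) ^ k := Nat.pow_le_pow_left h1 k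
      _ = k ^ k * (k + d + 1 - k) ^ k := mul_pow ..
      _ ≤ k ^ k * ((k + d).descFactorial k + (k + d)) := by
        gcongr
        exact (Nat.pow_sub_le_descFactorial _ _).trans (Nat.le_add_right _ _)

theorem Finset.card_filter_injective_piFinset {α : Type*} [DecidableEq α] (k : ℕ)
    (B : Finset α) :
    #{φ ∈ Fintype.piFinset fun _ : Fin k => B | Function.Injective φ} =
      (#B).descFactorial k := by
  have h := Fintype.card_embedding_eq (α := Fin k) (β := B)
  rw [Fintype.card_fin, Fintype.card_coe] at h
  rw [← h, ← Finset.card_univ]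
  symm
  refine Finset.card_bij (fun f _ i => (f i : α)) ?_ ?_ ?_
  · intro f _
    simp only [mem_filter, Fintype.mem_piFinset]
    exact ⟨fun i => (f i).2, Subtype.val_injective.comp f.injective⟩
  · intro f _ g _ hfg
    ext i
    exact congrFun hfg i
  · intro φ hφ
    simp only [mem_filter, Fintype.mem_piFinset] at hφ
    exact ⟨⟨fun i => ⟨φ i, hφ.1 i⟩, fun i j hij => hφ.2 (congrArg Subtype.val hij)⟩,
      mem_univ _, rfl⟩

theorem Finset.sum_sum_card_filter_and_le {α β : Type*} (P : Finset α) (D : Finset β)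
    (R : α → β → Prop) [∀ x s, Decidable (R x s)] (M : ℕ)
    (h : ∀ x ∈ P, #{s ∈ D | R x s} ≤ M) :
    ∑ s ∈ D, ∑ t ∈ D, #{x ∈ P | R x s ∧ R x t} ≤ #P * M ^ 2 := by
  calc ∑ s ∈ D, ∑ t ∈ D, #{x ∈ P | R x s ∧ R x t}
      = ∑ p ∈ D ×ˢ D, #{x ∈ P | R x p.1 ∧ R x p.2} := by rw [sum_product]
    _ = ∑ x ∈ P, #{p ∈ D ×ˢ D | R x p.1 ∧ R x p.2} := by
        simp only [card_filter]
        exact sum_comm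
    _ ≤ ∑ _x ∈ P, M ^ 2 := by
        refine sum_le_sum fun x hx => ?_
        rw [filter_product, card_product, sq]
        exact Nat.mul_le_mul (h x hx) (h x hx)
    _ = #P * M ^ 2 := by simp

theorem Finset.card_filter_forall_sub_mem_le {G : Type*} [AddCommGroup G] [DecidableEq G]
    {k C : ℕ} (hk : 1 ≤ k) (A D : Finset G)
    (hA : ∀ α : Fin (k - 1) → G, Function.Injective α → (∀ i, α i ≠ 0) →
      #{a ∈ A | ∀ i, a - α i ∈ A} ≤ C)
    (φ : Fin k → G) (hφ : Function.Injective φ) :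
    #{s ∈ D | ∀ i, φ i - s ∈ A} ≤ C := by
  obtain ⟨m, rfl⟩ := Nat.exists_eq_add_of_le' hk
  refine le_trans ?_ (hA (fun i => φ 0 - φ i.succ) ?_ ?_)
  · refine card_le_card_of_injOn (fun s => φ 0 - s) ?_ ?_
    · intro s hs
      simp only [coe_filter, Set.mem_ofPred_eq] at hs ⊢
      refine ⟨hs.2 0, fun i => ?_⟩
      rw [show φ 0 - s - (φ 0 - φ i.succ) = φ i.succ - s by abel]
      exact hs.2 _
    · exact fun s _ t _ hst => sub_right_injective hst
  · intro i j hij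
    exact Fin.succ_injective _ (hφ (sub_right_injective hij))
  · intro i hi
    exact Fin.succ_ne_zero i (hφ (sub_eq_zero.mp hi)).symm

/-- if every `(k−1)`-fold intersection of distinct nonzero shifts of `A` has at
most `C` elements (in an abelian group where nonzero elements have order at least `k`), then
the mixed energy `E_{3,k}(A) = Σ_{s,t} |A ∩ (A+s) ∩ (A+t)|^k` is at most `K·|A|^k`. -/
theorem mixed_energy_bound (k : ℕ) (hk : 4 ≤ k) (C : ℕ) (hC : 1 ≤ C) :
    ∃ K : ℕ, 1 ≤ K ∧
      ∀ (G : Type) [AddCommGroup G] [DecidableEq G],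
      ∀ (_ : ∀ g : G, g ≠ 0 → ∀ j : ℕ, 1 ≤ j → j < k → j • g ≠ 0),
      ∀ (A : Finset G),
        (∀ α : Fin (k - 1) → G, Function.Injective α → (∀ i, α i ≠ 0) →
          (A.filter (fun a => ∀ i, a - α i ∈ A)).card ≤ C) →
        ∑ s ∈ A - A, ∑ t ∈ A - A,
            (A.filter (fun a => a - s ∈ A ∧ a - t ∈ A)).card ^ k ≤
          K * A.card ^ k := by
  refine ⟨k ^ k * (C ^ 2 + 1), Nat.mul_pos (Nat.pow_pos (by omega)) (by omega), ?_⟩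
  intro G _ _ _ A hA
  have hgeneric : ∑ s ∈ A - A, ∑ t ∈ A - A,
      (#{a ∈ A | a - s ∈ A ∧ a - t ∈ A}).descFactorial k ≤ #A ^ k * C ^ 2 := by
    let P : Finset (Fin k → G) :=
      {φ ∈ Fintype.piFinset fun _ : Fin k => A | Function.Injective φ}
    have hP : #P ≤ #A ^ k := by
      refine (card_filter_le _ _).trans ?_
      simp
    refine le_trans (le_of_eq ?_) ((sum_sum_card_filter_and_le P (A - A)
      (fun φ s => ∀ i, φ i - s ∈ A) C fun φ hφ => ?_).trans (Nat.mul_le_mul_right _ hP))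
    · refine sum_congr rfl fun s _ => sum_congr rfl fun t _ => ?_
      rw [← card_filter_injective_piFinset]
      congr 1
      ext φ
      simp only [P, mem_filter, Fintype.mem_piFinset, forall_and]
      tauto
    · exact card_filter_forall_sub_mem_le (by omega) A _ hA φ (mem_filter.mp hφ).2
  have hlinear : ∑ s ∈ A - A, ∑ t ∈ A - A, #{a ∈ A | a - s ∈ A ∧ a - t ∈ A} ≤ #A ^ k := by
    refine (sum_sum_card_filter_and_le A (A - A) (fun a s => a - s ∈ A) #A fun a _ => ?_).trans ?_
    · refine card_le_card_of_injOn (fun s => a - s) ?_ ?_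
      · intro s hs
        exact (mem_filter.mp hs).2
      · exact fun s _ t _ hst => sub_right_injective hst
    · rw [← pow_succ']
      rcases Nat.eq_zero_or_pos #A with h | h
      · simp [h]
      · exact Nat.pow_le_pow_right h (by omega)
  calc ∑ s ∈ A - A, ∑ t ∈ A - A, #{a ∈ A | a - s ∈ A ∧ a - t ∈ A} ^ k
      ≤ ∑ s ∈ A - A, ∑ t ∈ A - A,
          k ^ k * ((#{a ∈ A | a - s ∈ A ∧ a - t ∈ A}).descFactorial k +
            #{a ∈ A | a - s ∈ A ∧ a - t ∈ A}) :=
        sum_le_sum fun s _ => sum_le_sum fun t _ =>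
          Nat.pow_le_pow_mul_descFactorial_add k _ (by omega)
    _ = k ^ k * (∑ s ∈ A - A, ∑ t ∈ A - A,
          (#{a ∈ A | a - s ∈ A ∧ a - t ∈ A}).descFactorial k +
            ∑ s ∈ A - A, ∑ t ∈ A - A, #{a ∈ A | a - s ∈ A ∧ a - t ∈ A}) := by
        simp only [← mul_sum, sum_add_distrib]
    _ ≤ k ^ k * (#A ^ k * C ^ 2 + #A ^ k) := by gcongr
    _ = k ^ k * (C ^ 2 + 1) * #A ^ k := by ring
end
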